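/- For every integer n ≥ 3 and every integer d ≥ 2, there exists an elastic collision system of n unit balls in ℝ^d on the time interval ℝ whose number of collisions is at least f(n). (Hence the maximal number K(n,d) of elastic collisions of n balls of equal radii and masses in d-dimensional space satisfies K(n,d) ≥ f(n).) -/

import Mathlib

open scoped RealInnerProductSpace

noncomputable section

/-- An elastic collision system of unit balls in `ℝ^d`, indexed by `ι`, on the time
interval `I ⊆ ℝ`.  `x i` is the trajectory of the center of ball `i`, `vr i t` its right
derivative (velocity) at time `t` and `vl i t` its left derivative (which, for a
continuous piecewise linear trajectory, is the left limit of the right derivative).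
Fields `right_lin` and `left_lin` say that each trajectory is (locally) linear to the
right and to the left of every time, with the indicated one-sided derivatives; this
encodes continuity and piecewise linearity with locally finitely many breakpoints.
`dist_ge` says the closed unit balls have disjoint interiors, and `collision_rule` is
the elastic collision rule: whenever the right derivative of `x i` changes at a time `t`
(having a left limit in `I`), there is exactly one `j ≠ i` with `‖x i t - x j t‖ = 2`,
the velocity of `x j` also changes at `t`, no other velocity changes at `t`, and with
`u = (x i t - x j t)/2` the usual exchange of normal velocity components holds. -/
structure BallSystem (ι : Type) (d : ℕ) (I : Set ℝ) where
  x : ι → ℝ → EuclideanSpace ℝ (Fin d)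
  vr : ι → ℝ → EuclideanSpace ℝ (Fin d)
  vl : ι → ℝ → EuclideanSpace ℝ (Fin d)
  right_lin : ∀ i, ∀ t ∈ I, ∃ ε > 0, ∀ s ∈ Set.Icc t (t + ε) ∩ I,
    x i s = x i t + (s - t) • vr i t
  left_lin : ∀ i, ∀ t ∈ I, ∃ ε > 0, ∀ s ∈ Set.Icc (t - ε) t ∩ I,
    x i s = x i t + (s - t) • vl i t
  dist_ge : ∀ i j, i ≠ j → ∀ t ∈ I, 2 ≤ ‖x i t - x j t‖
  collision_rule : ∀ i, ∀ t ∈ I, (∃ s ∈ I, s < t) → vr i t ≠ vl i t →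
    ∃ j, j ≠ i ∧ ‖x i t - x j t‖ = 2 ∧ vr j t ≠ vl j t ∧
      (∀ k, k ≠ i → ‖x i t - x k t‖ = 2 → k = j) ∧
      (∀ k, k ≠ i → k ≠ j → vr k t = vl k t) ∧
      vr i t = vl i t -
        ⟪vl i t - vl j t, (2⁻¹ : ℝ) • (x i t - x j t)⟫ • ((2⁻¹ : ℝ) • (x i t - x j t)) ∧
      vr j t = vl j t +
        ⟪vl i t - vl j t, (2⁻¹ : ℝ) • (x i t - x j t)⟫ • ((2⁻¹ : ℝ) • (x i t - x j t))

/-- The set of collisions of the system: pairs `(t, {i,j})` such that at time `t` the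
balls `i` and `j` are tangent and both of their velocities change at `t`. -/
def BallSystem.collisions {ι : Type} [DecidableEq ι] {d : ℕ} {I : Set ℝ}
    (S : BallSystem ι d I) : Set (ℝ × Finset ι) :=
  {p | p.1 ∈ I ∧ (∃ s ∈ I, s < p.1) ∧ ∃ i j : ι, i ≠ j ∧ p.2 = {i, j} ∧
    ‖S.x i p.1 - S.x j p.1‖ = 2 ∧ S.vr i p.1 ≠ S.vl i p.1 ∧ S.vr j p.1 ≠ S.vl j p.1}

/-- `n1 = ⌊n/3⌋`. -/
def nOne (n : ℕ) : ℕ := n / 3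

/-- `n2 = n - 2 n1`. -/
def nTwo (n : ℕ) : ℕ := n - 2 * (n / 3)

/-- `f(n) = n1 (n1+1) n2 + n2 (n2-1)/2 + n1 (n1-1)`. -/
def f (n : ℕ) : ℕ :=
  nOne n * (nOne n + 1) * nTwo n + nTwo n * (nTwo n - 1) / 2 + nOne n * (nOne n - 1)

end

namespace HardBall

open Set Filter Topology

section

variable {ι : Type} {E : Type*} [NormedAddCommGroup E] [InnerProductSpace ℝ E]

/-- The collision rule at one instant, for positions `p`, incoming velocities `v` and outgoing
velocities `w`, restricted to the balls in `S`. -/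
def Rule (S : Finset ι) (p v w : ι → E) : Prop :=
  ∀ i ∈ S, w i ≠ v i → ∃ j ∈ S, j ≠ i ∧ ‖p i - p j‖ = 2 ∧ w j ≠ v j ∧
    (∀ k ∈ S, k ≠ i → ‖p i - p k‖ = 2 → k = j) ∧
    (∀ k ∈ S, k ≠ i → k ≠ j → w k = v k) ∧
    w i = v i - ⟪v i - v j, (2⁻¹ : ℝ) • (p i - p j)⟫ • ((2⁻¹ : ℝ) • (p i - p j)) ∧
    w j = v j + ⟪v i - v j, (2⁻¹ : ℝ) • (p i - p j)⟫ • ((2⁻¹ : ℝ) • (p i - p j))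

theorem Rule.congr {S : Finset ι} {p v w p' v' w' : ι → E} (h : Rule S p v w)
    (hp : ∀ i ∈ S, p' i = p i) (hv : ∀ i ∈ S, v' i = v i) (hw : ∀ i ∈ S, w' i = w i) :
    Rule S p' v' w' := by
  intro i hi hne
  rw [hw i hi, hv i hi] at hne
  obtain ⟨j, hj, h1, h2, h3, h4, h5, h6, h7⟩ := h i hi hne
  refine ⟨j, hj, h1, ?_, ?_, ?_, ?_, ?_, ?_⟩
  · rwa [hp i hi, hp j hj]
  · rwa [hw j hj, hv j hj]
  · intro k hk
    rw [hp i hi, hp k hk]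
    exact h4 k hk
  · intro k hk hki hkj
    rw [hw k hk, hv k hk]
    exact h5 k hk hki hkj
  · rwa [hw i hi, hv i hi, hp i hi, hp j hj, hv j hj]
  · rwa [hw j hj, hv i hi, hp i hi, hp j hj, hv j hj]

theorem Rule.refl (S : Finset ι) (p v : ι → E) : Rule S p v v := fun _ _ h => absurd rfl h

theorem Rule.smul {S : Finset ι} {p v w : ι → E} (h : Rule S p v w) (c : ℝ) :
    Rule S p (c • v) (c • w) := by
  intro i hi hne
  have hne' : w i ≠ v i := fun e => hne (by simp [e])
  have hc : c ≠ 0 := by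
    rintro rfl
    simp at hne
  obtain ⟨j, hj, h1, h2, h3, h4, h5, h6, h7⟩ := h i hi hne'
  refine ⟨j, hj, h1, h2, ?_, h4, ?_, ?_, ?_⟩
  · exact fun e => h3 (smul_right_injective E hc e)
  · intro k hk hki hkj
    simp [h5 k hk hki hkj]
  · simp only [Pi.smul_apply, ← smul_sub c, h6]
    rw [real_inner_smul_left (v i - v j)]
    module
  · simp only [Pi.smul_apply, ← smul_sub c, h7]
    rw [real_inner_smul_left (v i - v j)]
    module

variable [DecidableEq ι]

/-- The elastic exchange of the components along `u` of the velocities of balls `i` and `j`. -/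
noncomputable def hit (u : E) (i j : ι) (v : ι → E) : ι → E := fun k =>
  if k = i then v i - ⟪v i - v j, u⟫ • u
  else if k = j then v j + ⟪v i - v j, u⟫ • u
  else v k

theorem hit_left (u : E) (i j : ι) (v : ι → E) :
    hit u i j v i = v i - ⟪v i - v j, u⟫ • u := by simp [hit]

theorem hit_right (u : E) {i j : ι} (h : i ≠ j) (v : ι → E) :
    hit u i j v j = v j + ⟪v i - v j, u⟫ • u := by simp [hit, h.symm]

theorem hit_of_ne (u : E) {i j k : ι} (hi : k ≠ i) (hj : k ≠ j) (v : ι → E) :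
    hit u i j v k = v k := by simp [hit, hi, hj]

theorem hit_swap (u : E) {i j : ι} (h : i ≠ j) (v : ι → E) :
    hit (-u) j i v = hit u i j v := by
  have e : ⟪v j - v i, u⟫ = -⟪v i - v j, u⟫ := by rw [← inner_neg_left]; simp
  funext k
  by_cases hi : k = i
  · subst hi
    rw [hit_left, hit_right _ h.symm, inner_neg_right, e]
    module
  · by_cases hj : k = j
    · subst hj
      rw [hit_left, hit_right _ h]
      simp [e]
    · rw [hit_of_ne _ hi hj, hit_of_ne _ hj hi]

theorem inner_hit_sub {u : E} (hu : ‖u‖ = 1) {i j : ι} (h : i ≠ j) (v : ι → E) :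
    ⟪hit u i j v i - hit u i j v j, u⟫ = -⟪v i - v j, u⟫ := by
  rw [hit_left, hit_right _ h]
  have : ⟪u, u⟫ = 1 := by rw [real_inner_self_eq_norm_sq, hu]; norm_num
  simp only [inner_sub_left, inner_add_left, real_inner_smul_left, this]
  ring

theorem hit_hit {u : E} (hu : ‖u‖ = 1) {i j : ι} (h : i ≠ j) (v : ι → E) :
    hit u i j (hit u i j v) = v := by
  funext k
  by_cases hi : k = i
  · subst hi
    rw [hit_left, inner_hit_sub hu h, hit_left]
    module
  · by_cases hj : k = j
    · subst hj
      rw [hit_right _ h, inner_hit_sub hu h, hit_right _ h]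
      module
    · rw [hit_of_ne _ hi hj, hit_of_ne _ hi hj]

theorem Rule.hit {S : Finset ι} {p v : ι → E} {a b : ι} (ha : a ∈ S) (hb : b ∈ S) (hab : a ≠ b)
    (hd : ‖p a - p b‖ = 2) (hv : ⟪v a - v b, (2⁻¹ : ℝ) • (p a - p b)⟫ ≠ 0)
    (hu : ∀ i ∈ S, ∀ j ∈ S, i ≠ j → ‖p i - p j‖ = 2 → (i = a ∧ j = b) ∨ (i = b ∧ j = a)) :
    Rule S p v (hit ((2⁻¹ : ℝ) • (p a - p b)) a b v) ∧
      HardBall.hit ((2⁻¹ : ℝ) • (p a - p b)) a b v a ≠ v a ∧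
      HardBall.hit ((2⁻¹ : ℝ) • (p a - p b)) a b v b ≠ v b := by
  set u := (2⁻¹ : ℝ) • (p a - p b) with hu'
  have hu0 : u ≠ 0 := by
    rintro h0
    simp [h0] at hv
  have hna : HardBall.hit u a b v a ≠ v a := by
    rw [hit_left]
    simpa using ⟨hv, hu0⟩
  have hnb : HardBall.hit u a b v b ≠ v b := by
    rw [hit_right _ hab]
    simpa using ⟨hv, hu0⟩
  have key : ∀ {a b : ι}, a ∈ S → b ∈ S → a ≠ b → ‖p a - p b‖ = 2 →
      (∀ i ∈ S, ∀ j ∈ S, i ≠ j → ‖p i - p j‖ = 2 → (i = a ∧ j = b) ∨ (i = b ∧ j = a)) →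
      HardBall.hit ((2⁻¹ : ℝ) • (p a - p b)) a b v b ≠ v b →
      ∃ j ∈ S, j ≠ a ∧ ‖p a - p j‖ = 2 ∧
      HardBall.hit ((2⁻¹ : ℝ) • (p a - p b)) a b v j ≠ v j ∧
    (∀ k ∈ S, k ≠ a → ‖p a - p k‖ = 2 → k = j) ∧
    (∀ k ∈ S, k ≠ a → k ≠ j → HardBall.hit ((2⁻¹ : ℝ) • (p a - p b)) a b v k = v k) ∧
    HardBall.hit ((2⁻¹ : ℝ) • (p a - p b)) a b v a =
      v a - ⟪v a - v j, (2⁻¹ : ℝ) • (p a - p j)⟫ • ((2⁻¹ : ℝ) • (p a - p j)) ∧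
    HardBall.hit ((2⁻¹ : ℝ) • (p a - p b)) a b v j =
      v j + ⟪v a - v j, (2⁻¹ : ℝ) • (p a - p j)⟫ • ((2⁻¹ : ℝ) • (p a - p j)) := by
    intro a b ha hb hab hd hu hnb
    refine ⟨b, hb, hab.symm, hd, hnb, ?_, ?_, hit_left _ _ _ _, hit_right _ hab _⟩
    · intro k hk hka hk2
      rcases hu a ha k hk hka.symm hk2 with h | h
      · exact h.2
      · exact absurd h.1 hab
    · intro k _ hka hkb
      exact hit_of_ne _ hka hkb v
  refine ⟨?_, hna, hnb⟩
  intro i hi hne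
  by_cases hia : i = a
  · subst hia
    exact key ha hb hab hd hu hnb
  · by_cases hib : i = b
    · subst hib
      have e : (2⁻¹ : ℝ) • (p i - p a) = -u := by rw [hu']; module
      have := key hb ha hab.symm (by rwa [norm_sub_rev])
        (fun i hi j hj hij h => (hu i hi j hj hij h).symm)
      rw [e, hit_swap u hab] at this
      exact this hna
    · exact absurd (hit_of_ne _ hia hib v) hne

/-- `x`, `vl`, `vr` describe an elastic motion of the balls in `S` on `(-∞, 0]` arriving at
positions `p` with velocities `v`, with collisions at least those recorded in `F`. -/
structure IsPast (S : Finset ι) (k : ℕ) (M : ℝ) (p v : ι → E) (x vl vr : ι → ℝ → E)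
    (F : Finset (ℝ × Finset ι)) : Prop where
  pos_zero : ∀ i ∈ S, x i 0 = p i
  vel_zero : ∀ i ∈ S, vl i 0 = v i
  right_lin : ∀ i ∈ S, ∀ t < 0, ∃ δ > 0, ∀ s ∈ Icc t (t + δ), x i s = x i t + (s - t) • vr i t
  left_lin : ∀ i ∈ S, ∀ t ≤ 0, ∃ δ > 0, ∀ s ∈ Icc (t - δ) t, x i s = x i t + (s - t) • vl i t
  dist_ge : ∀ i ∈ S, ∀ j ∈ S, i ≠ j → ∀ t ≤ 0, 2 ≤ ‖x i t - x j t‖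
  rule : ∀ t < 0, Rule S (fun i => x i t) (fun i => vl i t) (fun i => vr i t)
  coll : ∀ q ∈ F, q.1 < 0 ∧ ∃ i ∈ S, ∃ j ∈ S, i ≠ j ∧ q.2 = {i, j} ∧
    ‖x i q.1 - x j q.1‖ = 2 ∧ vr i q.1 ≠ vl i q.1 ∧ vr j q.1 ≠ vl j q.1
  card_le : k ≤ F.card
  speed : ∀ i ∈ S, ∀ t ≤ 0, ‖x i t - p i‖ ≤ M * (-t)

/-- There is a motion of the balls in `S` on `(-∞, 0]` with at least `k` collisions, with speeds
at most `M`, arriving at positions `p` with velocities `v`. -/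
def Past (S : Finset ι) (k : ℕ) (M : ℝ) (p v : ι → E) : Prop :=
  ∃ x vl vr F, IsPast S k M p v x vl vr F

theorem Past.empty (p v : ι → E) : Past ∅ 0 0 p v :=
  ⟨fun _ _ => 0, fun _ _ => 0, fun _ _ => 0, ∅, by constructor <;> simp [Rule]⟩

theorem Past.mono {S : Finset ι} {k : ℕ} {M M' : ℝ} {p v : ι → E} (h : Past S k M p v)
    (hM : M ≤ M') : Past S k M' p v := by
  obtain ⟨x, vl, vr, F, h⟩ := h
  refine ⟨x, vl, vr, F, { h with speed := fun i hi t ht => (h.speed i hi t ht).trans ?_ }⟩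
  have : 0 ≤ -t := by linarith
  gcongr

theorem Past.congr {S : Finset ι} {k : ℕ} {M : ℝ} {p v p' v' : ι → E} (h : Past S k M p v)
    (hp : ∀ i ∈ S, p' i = p i) (hv : ∀ i ∈ S, v' i = v i) : Past S k M p' v' := by
  obtain ⟨x, vl, vr, F, h⟩ := h
  exact ⟨x, vl, vr, F, { h with
    pos_zero := fun i hi => (h.pos_zero i hi).trans (hp i hi).symm
    vel_zero := fun i hi => (h.vel_zero i hi).trans (hv i hi).symm
    speed := fun i hi t ht => by rw [hp i hi]; exact h.speed i hi t ht }⟩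

/-- Slowing down a motion. -/
theorem Past.smul {S : Finset ι} {k : ℕ} {M : ℝ} {p v : ι → E} (h : Past S k M p v)
    {c : ℝ} (hc : 0 < c) : Past S k (c * M) p (c • v) := by
  obtain ⟨x, vl, vr, F, h⟩ := h
  refine ⟨fun i t => x i (c * t), fun i t => c • vl i (c * t), fun i t => c • vr i (c * t),
    F.map ⟨fun q => (q.1 / c, q.2), fun q q' hq => ?_⟩, ?_⟩
  · have h1 := congrArg Prod.fst hq
    have h2 := congrArg Prod.snd hq
    simp only at h1 h2
    refine Prod.ext ?_ h2
    field_simp at h1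
    exact h1
  have hneg : ∀ {t : ℝ}, t < 0 → c * t < 0 := fun ht => mul_neg_of_pos_of_neg hc ht
  have hneg' : ∀ {t : ℝ}, t ≤ 0 → c * t ≤ 0 := fun ht => mul_nonpos_of_nonneg_of_nonpos hc.le ht
  constructor
  · intro i hi
    simpa using h.pos_zero i hi
  · intro i hi
    simpa using congrArg (c • ·) (h.vel_zero i hi)
  · intro i hi t ht
    obtain ⟨δ, hδ, H⟩ := h.right_lin i hi _ (hneg ht)
    refine ⟨δ / c, by positivity, fun s hs => ?_⟩
    have h1 : c * t ≤ c * s := by have := hs.1; gcongr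
    have h2 : c * s ≤ c * t + δ := by
      have := mul_le_mul_of_nonneg_left hs.2 hc.le
      rwa [mul_add, mul_div_cancel₀ _ hc.ne'] at this
    rw [H _ ⟨h1, h2⟩]
    module
  · intro i hi t ht
    obtain ⟨δ, hδ, H⟩ := h.left_lin i hi _ (hneg' ht)
    refine ⟨δ / c, by positivity, fun s hs => ?_⟩
    have h1 : c * s ≤ c * t := by have := hs.2; gcongr
    have h2 : c * t - δ ≤ c * s := by
      have := mul_le_mul_of_nonneg_left hs.1 hc.le
      rwa [mul_sub, mul_div_cancel₀ _ hc.ne'] at this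
    rw [H _ ⟨h2, h1⟩]
    module
  · intro i hi j hj hij t ht
    exact h.dist_ge i hi j hj hij _ (hneg' ht)
  · intro t ht
    exact (h.rule _ (hneg ht)).smul c
  · intro q hq
    obtain ⟨q₀, hq₀, rfl⟩ := Finset.mem_map.1 hq
    obtain ⟨h0, i, hi, j, hj, hij, h1, h2, h3, h4⟩ := h.coll q₀ hq₀
    have e : c * (q₀.1 / c) = q₀.1 := mul_div_cancel₀ _ hc.ne'
    refine ⟨div_neg_of_neg_of_pos h0 hc, i, hi, j, hj, hij, h1, ?_, ?_, ?_⟩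
    · change ‖x i (c * (q₀.1 / c)) - x j (c * (q₀.1 / c))‖ = 2
      rwa [e]
    · change c • vr i (c * (q₀.1 / c)) ≠ c • vl i (c * (q₀.1 / c))
      rw [e]
      exact fun h' => h3 (smul_right_injective E hc.ne' h')
    · change c • vr j (c * (q₀.1 / c)) ≠ c • vl j (c * (q₀.1 / c))
      rw [e]
      exact fun h' => h4 (smul_right_injective E hc.ne' h')
  · simpa using h.card_le
  · intro i hi t ht
    refine (h.speed i hi _ (hneg' ht)).trans (le_of_eq ?_)
    ring

/-- Continuing a motion by a jump of the velocities followed by a free flight. -/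
theorem Past.extend {S : Finset ι} {k k' : ℕ} {M τ : ℝ} {p v v' : ι → E} (h : Past S k M p v)
    (hτ : 0 < τ) (hM : ∀ i ∈ S, ‖v' i‖ ≤ M)
    (hd : ∀ i ∈ S, ∀ j ∈ S, i ≠ j → ∀ s ∈ Icc 0 τ, 2 ≤ ‖p i - p j + s • (v' i - v' j)‖)
    (hr : Rule S p v v')
    (hk : k' = k ∨ (k' = k + 1 ∧ ∃ a ∈ S, ∃ b ∈ S, a ≠ b ∧ ‖p a - p b‖ = 2 ∧
      v' a ≠ v a ∧ v' b ≠ v b)) :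
    Past S k' M (p + τ • v') v' := by
  obtain ⟨x, vl, vr, F, h⟩ := h
  set x' : ι → ℝ → E := fun i t => if t ≤ -τ then x i (t + τ) else p i + (t + τ) • v' i with hx'
  set vl' : ι → ℝ → E := fun i t => if t ≤ -τ then vl i (t + τ) else v' i with hvl'
  set vr' : ι → ℝ → E := fun i t => if t < -τ then vr i (t + τ) else v' i with hvr'
  have x1 : ∀ {i t}, t ≤ -τ → x' i t = x i (t + τ) := fun ht => by simp [hx', ht]
  have x2 : ∀ {i t}, i ∈ S → -τ ≤ t → x' i t = p i + (t + τ) • v' i := fun {i t} hi ht => by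
    rcases ht.lt_or_eq with h' | h'
    · simp [hx', not_le.2 h']
    · simp [hx', ← h', h.pos_zero i hi]
  have l1 : ∀ {i t}, t ≤ -τ → vl' i t = vl i (t + τ) := fun ht => by simp [hvl', ht]
  have l2 : ∀ {i t}, -τ < t → vl' i t = v' i := fun ht => by simp [hvl', not_le.2 ht]
  have r1 : ∀ {i t}, t < -τ → vr' i t = vr i (t + τ) := fun ht => by simp [hvr', ht]
  have r2 : ∀ {i t}, -τ ≤ t → vr' i t = v' i := fun ht => by simp [hvr', not_lt.2 ht]
  set sh : ℝ × Finset ι ↪ ℝ × Finset ι := ⟨fun q => (q.1 - τ, q.2), fun q q' hq => by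
    have h1 := congrArg Prod.fst hq
    have h2 := congrArg Prod.snd hq
    simp only at h1 h2
    exact Prod.ext (by linarith) h2⟩ with hsh
  have hF : ∀ q ∈ F.map sh, q.1 < -τ ∧ ∃ i ∈ S, ∃ j ∈ S, i ≠ j ∧ q.2 = {i, j} ∧
      ‖x' i q.1 - x' j q.1‖ = 2 ∧ vr' i q.1 ≠ vl' i q.1 ∧ vr' j q.1 ≠ vl' j q.1 := by
    intro q hq
    obtain ⟨q₀, hq₀, rfl⟩ := Finset.mem_map.1 hq
    obtain ⟨h0, i, hi, j, hj, hij, h1, h2, h3, h4⟩ := h.coll q₀ hq₀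
    have e : (sh q₀).1 = q₀.1 - τ := rfl
    have h5 : q₀.1 - τ < -τ := by linarith
    rw [e]
    refine ⟨h5, i, hi, j, hj, hij, h1, ?_, ?_, ?_⟩
    · rw [x1 h5.le, x1 h5.le]; simpa using h2
    · rw [r1 h5, l1 h5.le]; simpa using h3
    · rw [r1 h5, l1 h5.le]; simpa using h4
  have base : ∀ G : Finset (ℝ × Finset ι), (∀ q ∈ G, q.1 < 0 ∧ ∃ i ∈ S, ∃ j ∈ S, i ≠ j ∧
      q.2 = {i, j} ∧ ‖x' i q.1 - x' j q.1‖ = 2 ∧ vr' i q.1 ≠ vl' i q.1 ∧ vr' j q.1 ≠ vl' j q.1) →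
      k' ≤ G.card → Past S k' M (p + τ • v') v' := by
    intro G hG hcard
    refine ⟨x', vl', vr', G, ?_, ?_, ?_, ?_, ?_, ?_, hG, hcard, ?_⟩
    · intro i hi
      rw [x2 hi (by linarith)]
      simp
    · intro i _
      exact l2 (by linarith)
    · intro i hi t ht
      by_cases htt : t < -τ
      · obtain ⟨δ, hδ, H⟩ := h.right_lin i hi (t + τ) (by linarith)
        refine ⟨min δ (-τ - t), lt_min hδ (by linarith), fun s hs => ?_⟩
        have h1 := hs.2
        have h2 := min_le_left δ (-τ - t)
        have h3 := min_le_right δ (-τ - t)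
        rw [x1 (by linarith), x1 htt.le, r1 htt, H _ ⟨by linarith [hs.1], by linarith⟩]
        module
      · push Not at htt
        refine ⟨1, one_pos, fun s hs => ?_⟩
        rw [x2 hi (by linarith [hs.1]), x2 hi htt, r2 htt]
        module
    · intro i hi t ht
      by_cases htt : t ≤ -τ
      · obtain ⟨δ, hδ, H⟩ := h.left_lin i hi (t + τ) (by linarith)
        refine ⟨δ, hδ, fun s hs => ?_⟩
        rw [x1 (by linarith [hs.2]), x1 htt, l1 htt, H _ ⟨by linarith [hs.1], by linarith [hs.2]⟩]
        module
      · push Not at htt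
        refine ⟨t + τ, by linarith, fun s hs => ?_⟩
        rw [x2 hi (by linarith [hs.1]), x2 hi htt.le, l2 htt]
        module
    · intro i hi j hj hij t ht
      by_cases htt : t ≤ -τ
      · rw [x1 htt, x1 htt]
        exact h.dist_ge i hi j hj hij _ (by linarith)
      · push Not at htt
        rw [x2 hi htt.le, x2 hj htt.le]
        convert hd i hi j hj hij (t + τ) ⟨by linarith, by linarith⟩ using 2
        module
    · intro t ht
      rcases lt_trichotomy t (-τ) with htt | htt | htt
      · exact (h.rule (t + τ) (by linarith)).congr (fun _ _ => x1 htt.le) (fun _ _ => l1 htt.le)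
          (fun _ _ => r1 htt)
      · refine hr.congr (fun i hi => ?_) (fun i hi => ?_) (fun i _ => r2 htt.ge)
        · rw [x2 hi htt.ge, htt]; simp
        · rw [l1 htt.le, htt]; simpa using h.vel_zero i hi
      · exact (Rule.refl S _ _).congr (fun _ _ => rfl) (fun _ _ => l2 htt) (fun _ _ => r2 htt.le)
    · intro i hi t ht
      have hMi := hM i hi
      by_cases htt : t ≤ -τ
      · have := h.speed i hi (t + τ) (by linarith)
        rw [x1 htt]
        have e : x i (t + τ) - (p + τ • v') i = (x i (t + τ) - p i) - τ • v' i := by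
          simp only [Pi.add_apply, Pi.smul_apply]; module
        rw [e]
        refine (norm_sub_le _ _).trans ?_
        rw [norm_smul, Real.norm_of_nonneg hτ.le]
        have := mul_le_mul_of_nonneg_left hMi hτ.le
        linarith
      · push Not at htt
        rw [x2 hi htt.le]
        have e : p i + (t + τ) • v' i - (p + τ • v') i = t • v' i := by
          simp only [Pi.add_apply, Pi.smul_apply]; module
        rw [e, norm_smul, Real.norm_of_nonpos ht, mul_comm]
        exact mul_le_mul_of_nonneg_right hMi (by linarith)
  rcases hk with rfl | ⟨rfl, a, ha, b, hb, hab, h2, hva, hvb⟩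
  · refine base (F.map sh) (fun q hq => ?_) (by simpa using h.card_le)
    obtain ⟨h0, h1⟩ := hF q hq
    exact ⟨by linarith, h1⟩
  · have hnot : ((-τ, {a, b}) : ℝ × Finset ι) ∉ F.map sh := fun hq => lt_irrefl _ (hF _ hq).1
    refine base (insert (-τ, {a, b}) (F.map sh)) (fun q hq => ?_) ?_
    · rcases Finset.mem_insert.1 hq with rfl | hq
      · refine ⟨by linarith, a, ha, b, hb, hab, rfl, ?_, ?_, ?_⟩
        · simpa [x2 ha le_rfl, x2 hb le_rfl] using h2
        · simpa [r2 le_rfl, l1 le_rfl, h.vel_zero a ha] using hva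
        · simpa [r2 le_rfl, l1 le_rfl, h.vel_zero b hb] using hvb
      · obtain ⟨h0, h1⟩ := hF q hq
        exact ⟨by linarith, h1⟩
    · rw [Finset.card_insert_of_notMem hnot, Finset.card_map]
      exact Nat.succ_le_succ h.card_le

end

section

variable {ι : Type} {E : Type*} [NormedAddCommGroup E]

/-- Two balls touch in the reference configuration. -/
def Touch (X : ι → E) (i j : ι) : Prop := i ≠ j ∧ ‖X i - X j‖ = 2

theorem Touch.symm {X : ι → E} {i j : ι} (h : Touch X i j) : Touch X j i :=
  ⟨h.1.symm, by rw [norm_sub_rev]; exact h.2⟩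

variable [InnerProductSpace ℝ E]

theorem le_norm_of_inner {w p : E} (h : 2 * ‖w‖ ≤ ⟪w, p⟫) (hw : w ≠ 0) : 2 ≤ ‖p‖ := by
  have h1 := real_inner_le_norm w p
  have h2 : 0 < ‖w‖ := norm_pos_iff.2 hw
  nlinarith

theorem lt_norm_of_inner {w p : E} (h : 2 * ‖w‖ < ⟪w, p⟫) : 2 < ‖p‖ := by
  have h1 := real_inner_le_norm w p
  have h2 := norm_nonneg w
  nlinarith

theorem flight_inner {w p d : E} {c τ s : ℝ} (h0 : c ≤ ⟪w, p⟫) (h1 : c ≤ ⟪w, p + τ • d⟫)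
    (hs : s ∈ Icc 0 τ) : c ≤ ⟪w, p + s • d⟫ := by
  rw [inner_add_right, real_inner_smul_right] at *
  obtain ⟨hs0, hs1⟩ := hs
  rcases le_total 0 ⟪w, d⟫ with hd | hd
  · nlinarith
  · nlinarith

theorem separating_norm {p d : E} {s : ℝ} (hp : 2 ≤ ‖p‖) (h : 0 ≤ ⟪p, d⟫) (hs : 0 ≤ s) :
    2 ≤ ‖p + s • d‖ := by
  have h1 : ‖p + s • d‖ ^ 2 = ‖p‖ ^ 2 + 2 * (s * ⟪p, d⟫) + ‖s • d‖ ^ 2 := by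
    rw [norm_add_sq_real, real_inner_smul_right]
  have h2 : 0 ≤ s * ⟪p, d⟫ := mul_nonneg hs h
  nlinarith [norm_nonneg (p + s • d), norm_nonneg (s • d)]

theorem exists_bound (S : Finset ι) (f : ι → ℝ) : ∃ B, ∀ i ∈ S, f i < B := by
  obtain ⟨M, hM⟩ := (S.image f).exists_le
  exact ⟨M + 1, fun i hi => by linarith [hM _ (Finset.mem_image_of_mem f hi)]⟩

theorem quadratic_root {a b c r : ℝ} (hr : r ^ 2 = b ^ 2 - 4 * a * c) (h : b + r ≠ 0) :
    c - 2 * c / (b + r) * b + a * (2 * c / (b + r)) ^ 2 = 0 := by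
  field_simp
  linear_combination c * hr

/-- The first order increase of half of the squared distance of two balls displaced from the
reference positions `X` by `y`. -/
noncomputable def gap (X y : ι → E) (i j : ι) : ℝ := ⟪X i - X j, y i - y j⟫

theorem gap_swap (X y : ι → E) (i j : ι) : gap X y j i = gap X y i j := by
  rw [gap, gap, ← neg_sub (X i), ← neg_sub (y i), inner_neg_neg]

theorem gap_add (X y z : ι → E) (i j : ι) : gap X (y + z) i j = gap X y i j + gap X z i j := by
  rw [gap, gap, gap, ← inner_add_right]
  congr 1
  simp only [Pi.add_apply]
  abel

theorem gap_smul (X y : ι → E) (c : ℝ) (i j : ι) : gap X (c • y) i j = c * gap X y i j := by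
  rw [gap, gap, ← real_inner_smul_right, smul_sub]
  rfl

theorem continuous_gap (X : ι → E) (i j : ι) : Continuous fun y => gap X y i j := by
  unfold gap
  fun_prop

theorem eventually_clear {X : ι → E} {y : ι → E} {i j : ι} (hX : 2 ≤ ‖X i - X j‖)
    (hy : ‖X i - X j‖ = 2 → 0 < gap X y i j) {α : Type*} {l : Filter α} {e : α → ℝ}
    {f : α → ι → E} (he : Tendsto e l (𝓝[>] 0)) (hf : Tendsto f l (𝓝 y)) :
    ∀ᶠ a in l, 2 * ‖X i - X j‖ < ⟪X i - X j, (X + e a • f a) i - (X + e a • f a) j⟫ := by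
  have h0 : ∀ᶠ a in l, 0 < e a := he.eventually self_mem_nhdsWithin
  have he' : Tendsto e l (𝓝 0) := he.mono_right nhdsWithin_le_nhds
  have hg : Tendsto (fun a => gap X (f a) i j) l (𝓝 (gap X y i j)) :=
    ((continuous_gap X i j).tendsto y).comp hf
  have key : ∀ a, ⟪X i - X j, (X + e a • f a) i - (X + e a • f a) j⟫ =
      ‖X i - X j‖ ^ 2 + e a * gap X (f a) i j := by
    intro a
    rw [gap, ← real_inner_self_eq_norm_sq, ← real_inner_smul_right, ← inner_add_right]
    congr 1
    simp only [Pi.add_apply, Pi.smul_apply]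
    module
  simp only [key]
  rcases hX.eq_or_lt with h | h
  · filter_upwards [h0, hg.eventually_const_lt (hy h.symm)] with a ha hb
    have := mul_pos ha hb
    rw [← h]
    linarith
  · have : Tendsto (fun a => ‖X i - X j‖ ^ 2 + e a * gap X (f a) i j) l
        (𝓝 (‖X i - X j‖ ^ 2 + 0 * gap X y i j)) := (he'.mul hg).const_add _
    refine this.eventually_const_lt ?_
    nlinarith

variable [DecidableEq ι]

/-- The balls in `S`, at positions `X + ε y` with velocities `v`, have a past with at least `k`
collisions and speeds at most `M` for every small `ε > 0`, uniformly for `(y, v)` near `z`. -/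
def NearPast (X : ι → E) (S : Finset ι) (k : ℕ) (M : ℝ) (z : (ι → E) × (ι → E)) : Prop :=
  ∀ᶠ q in 𝓝[>] (0 : ℝ) ×ˢ 𝓝 z, Past S k M (X + q.1 • q.2.1) q.2.2

/-- States `(y, v)` of first order displacements and velocities for which the balls in `S` have
a past with at least `k` collisions and the touching pairs have positive gaps. -/
def Hist (X : ι → E) (S : Finset ι) (k : ℕ) : Set ((ι → E) × (ι → E)) :=
  {z | (∀ i ∈ S, ∀ j ∈ S, Touch X i j → 0 < gap X z.1 i j) ∧
    ∃ M, NearPast X S k M z}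

theorem isOpen_hist (X : ι → E) (S : Finset ι) (k : ℕ) : IsOpen (Hist X S k) := by
  rw [isOpen_iff_mem_nhds]
  rintro z ⟨hz, M, hM⟩
  have h1 : ∀ᶠ z' in 𝓝 z, ∀ i ∈ S, ∀ j ∈ S, Touch X i j → 0 < gap X z'.1 i j := by
    rw [Finset.eventually_all]
    intro i hi
    rw [Finset.eventually_all]
    intro j hj
    by_cases h : Touch X i j
    · have : Continuous fun z' : (ι → E) × (ι → E) => gap X z'.1 i j :=
        (continuous_gap X i j).comp continuous_fst
      filter_upwards [this.continuousAt.eventually_const_lt (hz i hi j hj h)] with z' h' _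
      exact h'
    · exact Eventually.of_forall fun _ h' => absurd h' h
  obtain ⟨pa, ha, pb, hb, hp⟩ := eventually_prod_iff.1 hM
  filter_upwards [h1, eventually_eventually_nhds.2 hb] with z' h1' hb'
  exact ⟨h1', M, eventually_prod_iff.2 ⟨pa, ha, pb, hb', hp⟩⟩

theorem NearPast.smul {X : ι → E} {S : Finset ι} {k : ℕ} {M : ℝ} {y v : ι → E}
    (h : NearPast X S k M (y, v)) {c : ℝ} (hc : 0 < c) : NearPast X S k (c * M) (y, c • v) := by
  have ht : Tendsto (fun q : ℝ × (ι → E) × (ι → E) => (q.1, (q.2.1, c⁻¹ • q.2.2)))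
      (𝓝[>] (0 : ℝ) ×ˢ 𝓝 (y, c • v)) (𝓝[>] (0 : ℝ) ×ˢ 𝓝 (y, v)) := by
    have : Continuous fun z : (ι → E) × (ι → E) => (z.1, c⁻¹ • z.2) := by fun_prop
    have h' := this.tendsto (y, c • v)
    simp only [smul_smul, inv_mul_cancel₀ hc.ne', one_smul] at h'
    exact tendsto_fst.prodMk (h'.comp tendsto_snd)
  filter_upwards [ht.eventually h] with q hq
  simpa [smul_smul, mul_inv_cancel₀ hc.ne'] using hq.smul hc

theorem NearPast.congr {X : ι → E} {S : Finset ι} {k : ℕ} {M : ℝ} {y v y' v' : ι → E}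
    (h : NearPast X S k M (y, v)) (hy : ∀ i ∈ S, y' i = y i) (hv : ∀ i ∈ S, v' i = v i) :
    NearPast X S k M (y', v') := by
  set r : (ι → E) → (ι → E) → ι → E := fun a b i => if i ∈ S then a i else b i with hr
  have hc : ∀ b, Continuous fun a => r a b := by
    intro b
    refine continuous_pi fun i => ?_
    by_cases hi : i ∈ S
    · simp only [hr, if_pos hi]; fun_prop
    · simp only [hr, if_neg hi]; fun_prop
  have e : ∀ {a b : ι → E}, (∀ i ∈ S, a i = b i) → r a b = b := by
    intro a b hab
    funext i
    by_cases hi : i ∈ S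
    · simp [hr, hi, hab i hi]
    · simp [hr, hi]
  have ht : Tendsto (fun q : ℝ × (ι → E) × (ι → E) => (q.1, (r q.2.1 y, r q.2.2 v)))
      (𝓝[>] (0 : ℝ) ×ˢ 𝓝 (y', v')) (𝓝[>] (0 : ℝ) ×ˢ 𝓝 (y, v)) := by
    have : Continuous fun z : (ι → E) × (ι → E) => (r z.1 y, r z.2 v) :=
      ((hc y).comp continuous_fst).prodMk ((hc v).comp continuous_snd)
    have h' := this.tendsto (y', v')
    simp only [e hy, e hv] at h'
    exact tendsto_fst.prodMk (h'.comp tendsto_snd)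
  filter_upwards [ht.eventually h] with q hq
  refine hq.congr (fun i hi => ?_) (fun i hi => ?_)
  · simp [hr, hi]
  · simp [hr, hi]

theorem tendsto_hit {α : Type*} {l : Filter α} {f : α → E} {g : α → ι → E} {u : E} {v : ι → E}
    (hf : Tendsto f l (𝓝 u)) (hg : Tendsto g l (𝓝 v)) (i j : ι) :
    Tendsto (fun a => hit (f a) i j (g a)) l (𝓝 (hit u i j v)) := by
  rw [tendsto_pi_nhds] at hg ⊢
  have h := (((hg i).sub (hg j)).inner (𝕜 := ℝ) hf).smul hf
  intro k
  by_cases hi : k = i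
  · subst hi
    simp only [hit_left]
    exact (hg _).sub h
  · by_cases hj : k = j
    · simp only [hit, if_neg hi, if_pos hj]
      exact (hg _).add h
    · simp only [hit_of_ne _ hi hj]
      exact hg k

/-- The velocity exchange of two balls touching in the reference configuration `X`. -/
noncomputable def bounce (X : ι → E) (i j : ι) (v : ι → E) : ι → E :=
  hit ((2⁻¹ : ℝ) • (X i - X j)) i j v

theorem norm_half {p : E} (h : ‖p‖ = 2) : ‖(2⁻¹ : ℝ) • p‖ = 1 := by
  rw [norm_smul, h]
  norm_num

theorem gap_bounce {X : ι → E} {i j : ι} (h : Touch X i j) (v : ι → E) :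
    gap X (bounce X i j v) i j = -gap X v i j := by
  have := inner_hit_sub (norm_half h.2) h.1 v
  rw [real_inner_smul_right, real_inner_smul_right, real_inner_comm (X i - X j),
    real_inner_comm (X i - X j)] at this
  simp only [gap, bounce]
  linarith

theorem bounce_bounce {X : ι → E} {i j : ι} (h : Touch X i j) (v : ι → E) :
    bounce X i j (bounce X i j v) = v := hit_hit (norm_half h.2) h.1 v

theorem bounce_swap {X : ι → E} {i j : ι} (h : i ≠ j) (v : ι → E) :
    bounce X j i v = bounce X i j v := by
  rw [bounce, bounce, ← hit_swap _ h]
  congr 1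
  module

/-- A motion whose balls `i`, `j` come into contact after a free flight, all other balls staying
apart, can be continued by the flight, the collision and another flight. -/
theorem Past.bounce {S : Finset ι} {k : ℕ} {M τ σ : ℝ} {p v : ι → E} {i j : ι}
    (h : Past S k M p v) (hi : i ∈ S) (hj : j ∈ S) (hij : i ≠ j) (hτ : 0 < τ) (hσ : 0 < σ)
    (hn : ‖(p + τ • v) i - (p + τ • v) j‖ = 2)
    (hv : ⟪(p + τ • v) i - (p + τ • v) j, v i - v j⟫ < 0)
    {w : ι → E} (hw : w = hit ((2⁻¹ : ℝ) • ((p + τ • v) i - (p + τ • v) j)) i j v)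
    (hM : ∀ i ∈ S, ‖v i‖ ≤ M) (hM' : ∀ i ∈ S, ‖w i‖ ≤ M) (X : ι → E)
    (hX : ∀ a ∈ S, ∀ b ∈ S, a ≠ b → ¬(a = i ∧ b = j) → ¬(a = j ∧ b = i) →
      2 * ‖X a - X b‖ < ⟪X a - X b, p a - p b⟫ ∧
      2 * ‖X a - X b‖ < ⟪X a - X b, (p + τ • v) a - (p + τ • v) b⟫ ∧
      2 * ‖X a - X b‖ < ⟪X a - X b, (p + τ • v + σ • w) a - (p + τ • v + σ • w) b⟫) :
    Past S (k + 1) M (p + τ • v + σ • w) w := by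
  set c := p + τ • v with hc
  have hca : ∀ a b, c a - c b = p a - p b + τ • (v a - v b) := by
    intro a b; simp only [hc, Pi.add_apply, Pi.smul_apply]; module
  have hcw : ∀ a b, (c + σ • w) a - (c + σ • w) b = c a - c b + σ • (w a - w b) := by
    intro a b; simp only [Pi.add_apply, Pi.smul_apply]; module
  have hne : ∀ {a b}, 2 * ‖X a - X b‖ < ⟪X a - X b, c a - c b⟫ → X a - X b ≠ 0 := by
    intro a b h h0
    simp [h0] at h
  have hu := norm_half hn
  have hvu : ⟪v i - v j, (2⁻¹ : ℝ) • (c i - c j)⟫ < 0 := by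
    rw [real_inner_smul_right, real_inner_comm]
    linarith
  have hsep : 0 ≤ ⟪c i - c j, w i - w j⟫ := by
    have := inner_hit_sub hu hij v
    rw [← hw, real_inner_smul_right, real_inner_comm] at this
    linarith
  have neg_inner : ∀ {a b c d : E}, ⟪a - b, c - d⟫ = ⟪b - a, d - c⟫ := by
    intro a b c d
    rw [← neg_sub b a, ← neg_sub d c, inner_neg_neg]
  have before : ∀ s ∈ Icc 0 τ, 2 ≤ ‖p i - p j + s • (v i - v j)‖ := by
    intro s hs
    have e : p i - p j + s • (v i - v j) = (c i - c j) + (τ - s) • -(v i - v j) := by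
      rw [hca]; module
    rw [e]
    refine separating_norm hn.ge ?_ (by linarith [hs.2])
    rw [inner_neg_right]
    linarith
  have after : ∀ s ∈ Icc 0 σ, 2 ≤ ‖c i - c j + s • (w i - w j)‖ := fun s hs =>
    separating_norm hn.ge hsep hs.1
  have flip : ∀ {a b c d : E} {s : ℝ}, 2 ≤ ‖a - b + s • (c - d)‖ → 2 ≤ ‖b - a + s • (d - c)‖ := by
    intro a b c d s h
    have e : -(b - a + s • (d - c)) = a - b + s • (c - d) := by module
    rwa [← norm_neg, e]
  have h1 : Past S k M c v := by
    refine h.extend hτ hM ?_ (Rule.refl S p v) (Or.inl rfl)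
    intro a ha b hb hab s hs
    by_cases h1 : a = i ∧ b = j
    · obtain ⟨rfl, rfl⟩ := h1
      exact before s hs
    by_cases h2 : a = j ∧ b = i
    · obtain ⟨rfl, rfl⟩ := h2
      exact flip (before s hs)
    obtain ⟨x1, x2, -⟩ := hX a ha b hb hab h1 h2
    have x2' := x2
    rw [hca] at x2
    exact le_norm_of_inner (flight_inner x1.le x2.le hs) (hne x2')
  obtain ⟨r1, r2, r3⟩ := Rule.hit (p := c) (v := v) hi hj hij hn hvu.ne (by
    intro a ha b hb hab h2
    by_contra hcon
    rw [not_or] at hcon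
    obtain ⟨-, x2, -⟩ := hX a ha b hb hab hcon.1 hcon.2
    exact (lt_norm_of_inner x2).ne' h2)
  rw [← hw] at r1 r2 r3
  refine h1.extend hσ hM' ?_ r1 (Or.inr ⟨rfl, i, hi, j, hj, hij, hn, r2, r3⟩)
  intro a ha b hb hab s hs
  by_cases h1 : a = i ∧ b = j
  · obtain ⟨rfl, rfl⟩ := h1
    exact after s hs
  by_cases h2 : a = j ∧ b = i
  · obtain ⟨rfl, rfl⟩ := h2
    exact flip (after s hs)
  obtain ⟨-, x2, x3⟩ := hX a ha b hb hab h1 h2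
  rw [hcw] at x3
  exact le_norm_of_inner (flight_inner x2.le x3.le hs) (hne x2)

end

section

variable {ι : Type} {E : Type*} [NormedAddCommGroup E] [InnerProductSpace ℝ E] [DecidableEq ι]

theorem contact_norm {w y d : E} {e s : ℝ} (hw : ‖w‖ = 2)
    (h : ⟪w, y⟫ + e / 2 * ‖y‖ ^ 2 - s * (⟪w, d⟫ + e * ⟪y, d⟫) + e / 2 * ‖d‖ ^ 2 * s ^ 2 = 0) :
    ‖w + e • (y - s • d)‖ = 2 := by
  have h1 : ‖w + e • (y - s • d)‖ ^ 2 = 2 ^ 2 := by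
    rw [norm_add_sq_real, hw, norm_smul, mul_pow, real_inner_smul_right, inner_sub_right,
      norm_sub_sq_real, real_inner_smul_right, real_inner_smul_right, norm_smul, mul_pow,
      Real.norm_eq_abs, Real.norm_eq_abs, sq_abs, sq_abs]
    linear_combination 2 * e * h
  exact (sq_eq_sq₀ (norm_nonneg _) zero_le_two).1 h1

/-- If a flight of duration `τ` brings exactly the touching pair `i`, `j` to zero gap, with the
balls approaching each other, a history can be continued through the collision of this pair. -/
theorem Hist.step {X : ι → E} {S : Finset ι} {k : ℕ} {y v : ι → E} (h : (y, v) ∈ Hist X S k)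
    (hX : ∀ a ∈ S, ∀ b ∈ S, a ≠ b → 2 ≤ ‖X a - X b‖) {i j : ι} (hi : i ∈ S) (hj : j ∈ S)
    (hij : Touch X i j) {τ : ℝ} (hτ : 0 < τ) (hg : gap X (y + τ • v) i j = 0)
    (hv : gap X v i j < 0)
    (ho : ∀ a ∈ S, ∀ b ∈ S, Touch X a b → ¬(a = i ∧ b = j) → ¬(a = j ∧ b = i) →
      0 < gap X (y + τ • v) a b) :
    ∀ᶠ σ in 𝓝[>] (0 : ℝ), (y + τ • v + σ • bounce X i j v, bounce X i j v) ∈ Hist X S (k + 1) := by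
  set u := y + τ • v with hu
  set w := bounce X i j v with hw
  have hwg : gap X w i j = -gap X v i j := gap_bounce hij v
  have hb0 : 0 < gap X w i j := by rw [hwg]; linarith
  have hsmall : ∀ᶠ σ in 𝓝[>] (0 : ℝ), ∀ a ∈ S, ∀ b ∈ S, Touch X a b →
      ¬(a = i ∧ b = j) → ¬(a = j ∧ b = i) → 0 < gap X (u + σ • w) a b := by
    rw [Finset.eventually_all]
    intro a ha
    rw [Finset.eventually_all]
    intro b hb
    by_cases hc : Touch X a b ∧ ¬(a = i ∧ b = j) ∧ ¬(a = j ∧ b = i)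
    · have : Continuous fun σ : ℝ => gap X (u + σ • w) a b :=
        (continuous_gap X a b).comp (by fun_prop)
      have h0 : 0 < gap X (u + (0 : ℝ) • w) a b := by
        simpa using ho a ha b hb hc.1 hc.2.1 hc.2.2
      filter_upwards [(this.continuousAt.eventually_const_lt h0).filter_mono
        nhdsWithin_le_nhds] with σ hσ _ _ _
      exact hσ
    · exact Eventually.of_forall fun _ h1 h2 h3 => absurd ⟨h1, h2, h3⟩ hc
  filter_upwards [hsmall, self_mem_nhdsWithin] with σ hσo hσ
  rw [mem_Ioi] at hσ
  set z := u + σ • w with hz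
  have hzg : gap X z i j = σ * gap X w i j := by rw [hz, gap_add, gap_smul, hg, zero_add]
  have hzall : ∀ a ∈ S, ∀ b ∈ S, Touch X a b → 0 < gap X z a b := by
    intro a ha b hb hab
    by_cases h1 : a = i ∧ b = j
    · rw [h1.1, h1.2, hzg]; positivity
    by_cases h2 : a = j ∧ b = i
    · rw [h2.1, h2.2, gap_swap, hzg]; positivity
    exact hσo a ha b hb hab h1 h2
  refine ⟨hzall, ?_⟩
  obtain ⟨hyall, M, hM⟩ := h
  obtain ⟨B₁, hB₁⟩ := exists_bound S fun a => ‖v a‖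
  obtain ⟨B₂, hB₂⟩ := exists_bound S fun a => ‖w a‖
  refine ⟨max M (max B₁ B₂), ?_⟩
  set l : Filter (ℝ × (ι → E) × (ι → E)) := 𝓝[>] (0 : ℝ) ×ˢ 𝓝 (z, w) with hl
  have t0 : Tendsto (fun q : ℝ × (ι → E) × (ι → E) => q.1) l (𝓝[>] 0) := tendsto_fst
  have t0' : Tendsto (fun q : ℝ × (ι → E) × (ι → E) => q.1) l (𝓝 0) :=
    t0.mono_right nhdsWithin_le_nhds
  have t1 : Tendsto (fun q : ℝ × (ι → E) × (ι → E) => q.2.1) l (𝓝 z) :=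
    (continuous_fst.tendsto (z, w)).comp tendsto_snd
  have t2 : Tendsto (fun q : ℝ × (ι → E) × (ι → E) => q.2.2) l (𝓝 w) :=
    (continuous_snd.tendsto (z, w)).comp tendsto_snd
  have td : ∀ {f : ℝ × (ι → E) × (ι → E) → ι → E} {s : ι → E}, Tendsto f l (𝓝 s) →
      Tendsto (fun q => f q i - f q j) l (𝓝 (s i - s j)) := fun hf =>
    ((tendsto_pi_nhds.1 hf) i).sub ((tendsto_pi_nhds.1 hf) j)
  set a : ℝ × (ι → E) × (ι → E) → ℝ := fun q => q.1 / 2 * ‖q.2.2 i - q.2.2 j‖ ^ 2 with ha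
  set b : ℝ × (ι → E) × (ι → E) → ℝ := fun q => ⟪X i - X j, q.2.2 i - q.2.2 j⟫ +
    q.1 * ⟪q.2.1 i - q.2.1 j, q.2.2 i - q.2.2 j⟫ with hb
  set c : ℝ × (ι → E) × (ι → E) → ℝ := fun q => ⟪X i - X j, q.2.1 i - q.2.1 j⟫ +
    q.1 / 2 * ‖q.2.1 i - q.2.1 j‖ ^ 2 with hc
  set D : ℝ × (ι → E) × (ι → E) → ℝ := fun q => b q ^ 2 - 4 * a q * c q with hD
  set r : ℝ × (ι → E) × (ι → E) → ℝ := fun q => 2 * c q / (b q + √(D q)) with hr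
  have ta : Tendsto a l (𝓝 0) := by
    have := (t0'.div_const 2).mul ((td t2).norm.pow 2)
    simpa using this
  have tb : Tendsto b l (𝓝 (gap X w i j)) := by
    have := ((tendsto_const_nhds (x := X i - X j)).inner (𝕜 := ℝ) (td t2)).add
      (t0'.mul ((td t1).inner (𝕜 := ℝ) (td t2)))
    simpa [gap] using this
  have tc : Tendsto c l (𝓝 (gap X z i j)) := by
    have := ((tendsto_const_nhds (x := X i - X j)).inner (𝕜 := ℝ) (td t1)).add
      ((t0'.div_const 2).mul ((td t1).norm.pow 2))
    simpa [gap] using this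
  have tD : Tendsto D l (𝓝 (gap X w i j ^ 2)) := by
    have := (tb.pow 2).sub ((ta.const_mul 4).mul tc)
    simpa using this
  have tr : Tendsto r l (𝓝 σ) := by
    have hne : gap X w i j + √(gap X w i j ^ 2) ≠ 0 := by
      rw [Real.sqrt_sq hb0.le]; positivity
    have := (tc.const_mul 2).div (tb.add tD.sqrt) hne
    have e : 2 * gap X z i j / (gap X w i j + √(gap X w i j ^ 2)) = σ := by
      rw [Real.sqrt_sq hb0.le, hzg]
      field_simp
      ring
    rwa [e] at this
  set yc : ℝ × (ι → E) × (ι → E) → ι → E := fun q => q.2.1 - r q • q.2.2 with hyc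
  have tyc : Tendsto yc l (𝓝 u) := by
    have := t1.sub (tr.smul t2)
    simpa [hz] using this
  set N : ℝ × (ι → E) × (ι → E) → E := fun q => X i - X j + q.1 • (yc q i - yc q j) with hN
  have tN : Tendsto N l (𝓝 (X i - X j)) := by
    have := (t0'.smul (td tyc)).const_add (X i - X j)
    simpa using this
  set v' : ℝ × (ι → E) × (ι → E) → ι → E := fun q => hit ((2⁻¹ : ℝ) • N q) i j q.2.2 with hv'
  have tv' : Tendsto v' l (𝓝 v) := by
    have := tendsto_hit (tN.const_smul (2⁻¹ : ℝ)) t2 i j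
    have e : hit ((2⁻¹ : ℝ) • (X i - X j)) i j w = v := bounce_bounce hij v
    rwa [e] at this
  set y' : ℝ × (ι → E) × (ι → E) → ι → E := fun q => yc q - τ • v' q with hy'
  have ty' : Tendsto y' l (𝓝 y) := by
    have := tyc.sub (tv'.const_smul τ)
    simpa [hu] using this
  have tq : Tendsto (fun q : ℝ × (ι → E) × (ι → E) => (q.1, (y' q, v' q))) l
      (𝓝[>] (0 : ℝ) ×ˢ 𝓝 (y, v)) := by
    refine t0.prodMk ?_
    rw [nhds_prod_eq]
    exact ty'.prodMk tv'
  have apart : ∀ᶠ q in l, ∀ a ∈ S, ∀ b ∈ S, a ≠ b → ¬(a = i ∧ b = j) → ¬(a = j ∧ b = i) →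
      2 * ‖X a - X b‖ < ⟪X a - X b, (X + q.1 • y' q) a - (X + q.1 • y' q) b⟫ ∧
      2 * ‖X a - X b‖ < ⟪X a - X b, (X + q.1 • yc q) a - (X + q.1 • yc q) b⟫ ∧
      2 * ‖X a - X b‖ < ⟪X a - X b, (X + q.1 • q.2.1) a - (X + q.1 • q.2.1) b⟫ := by
    rw [Finset.eventually_all]
    intro a ha
    rw [Finset.eventually_all]
    intro b hb
    by_cases hc : a ≠ b ∧ ¬(a = i ∧ b = j) ∧ ¬(a = j ∧ b = i)
    · have h2 := hX a ha b hb hc.1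
      filter_upwards [eventually_clear h2 (fun h => hyall a ha b hb ⟨hc.1, h⟩) t0 ty',
        eventually_clear h2 (fun h => ho a ha b hb ⟨hc.1, h⟩ hc.2.1 hc.2.2) t0 tyc,
        eventually_clear h2 (fun h => hzall a ha b hb ⟨hc.1, h⟩) t0 t1] with q h3 h4 h5 _ _ _
      exact ⟨h3, h4, h5⟩
    · exact Eventually.of_forall fun _ h1 h2 h3 => absurd ⟨h1, h2, h3⟩ hc
  have speed : ∀ᶠ q in l, ∀ a ∈ S, ‖v' q a‖ < B₁ ∧ ‖q.2.2 a‖ < B₂ := by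
    rw [Finset.eventually_all]
    intro a ha
    exact (((tendsto_pi_nhds.1 tv') a).norm.eventually_lt_const (hB₁ a ha)).and
      (((tendsto_pi_nhds.1 t2) a).norm.eventually_lt_const (hB₂ a ha))
  have closing : ∀ᶠ q in l, ⟪N q, v' q i - v' q j⟫ < 0 :=
    (tN.inner (𝕜 := ℝ) (td tv')).eventually_lt_const hv
  filter_upwards [tq.eventually hM, t0.eventually self_mem_nhdsWithin, apart, speed, closing,
    tr.eventually_const_lt hσ, tb.eventually_const_lt hb0,
    tD.eventually_const_lt (pow_pos hb0 2)] with q hpast hε hclear hspeed hclose hrq hbq hDq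
  have hNn : ‖N q‖ = 2 := by
    have e : yc q i - yc q j = (q.2.1 i - q.2.1 j) - r q • (q.2.2 i - q.2.2 j) := by
      simp only [hyc, Pi.sub_apply, Pi.smul_apply]; module
    rw [hN]
    simp only [e]
    refine contact_norm hij.2 ?_
    have := quadratic_root (a := a q) (b := b q) (c := c q) (Real.sq_sqrt hDq.le)
      (by positivity)
    linear_combination this
  have e1 : X + q.1 • y' q + (q.1 * τ) • v' q = X + q.1 • yc q := by
    rw [hy']
    module
  have e2 : X + q.1 • yc q + (q.1 * r q) • q.2.2 = X + q.1 • q.2.1 := by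
    rw [hyc]
    module
  have eN : (X + q.1 • yc q) i - (X + q.1 • yc q) j = N q := by
    simp only [hN, Pi.add_apply, Pi.smul_apply]; module
  have := Past.bounce (hpast.mono (le_max_left M (max B₁ B₂))) hi hj hij.1 (mul_pos hε hτ)
    (mul_pos hε hrq) (w := q.2.2) (by rw [e1, eN, hNn]) (by rw [e1, eN]; exact hclose)
    (by rw [e1, eN]; exact (hit_hit (norm_half hNn) hij.1 _).symm)
    (fun a ha => (hspeed a ha).1.le.trans ((le_max_left _ _).trans (le_max_right _ _)))
    (fun a ha => (hspeed a ha).2.le.trans ((le_max_right _ _).trans (le_max_right _ _))) X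
    (by rw [e1, e2]; exact hclear)
  rwa [e1, e2] at this

end

section

theorem add_div_neg_mul {a g : ℝ} (h : g ≠ 0) : a + a / (-g) * g = 0 := by
  rw [div_neg, neg_mul, div_mul_cancel₀ _ h, add_neg_cancel]

variable {ι : Type} {E : Type*} [NormedAddCommGroup E] [InnerProductSpace ℝ E] [DecidableEq ι]

theorem gap_single_of_ne (X : ι → E) (w : E) {i a b : ι} (ha : a ≠ i) (hb : b ≠ i) :
    gap X (Pi.single i w) a b = 0 := by
  simp [gap, ha, hb]

theorem gap_single {X : ι → E} {i j : ι} (h : Touch X i j) :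
    gap X (Pi.single i (X i - X j)) i j = 4 := by
  rw [gap, Pi.single_eq_same, Pi.single_eq_of_ne h.1.symm, sub_zero, real_inner_self_eq_norm_sq, h.2]
  norm_num

/-- A version of `Hist.step` allowing simultaneous contacts of disjoint pairs. -/
theorem Hist.step_closure {X : ι → E} {S : Finset ι} {k : ℕ} {y v : ι → E}
    (h : (y, v) ∈ Hist X S k) (hX : ∀ a ∈ S, ∀ b ∈ S, a ≠ b → 2 ≤ ‖X a - X b‖)
    {i j : ι} (hi : i ∈ S) (hj : j ∈ S) (hij : Touch X i j) {τ : ℝ} (hτ : 0 < τ)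
    (hg : gap X (y + τ • v) i j = 0) (hv : gap X v i j < 0)
    (ho : ∀ a ∈ S, ∀ b ∈ S, Touch X a b → ¬(a = i ∧ b = j) → ¬(a = j ∧ b = i) →
      0 < gap X (y + τ • v) a b ∨ (a ≠ i ∧ b ≠ i ∧ 0 ≤ gap X (y + τ • v) a b)) :
    (y + τ • v, bounce X i j v) ∈ closure (Hist X S (k + 1) ∩ {z | z.2 = bounce X i j v}) := by
  set w := bounce X i j v with hw
  set s : ι → E := Pi.single i (X i - X j) with hs
  set g := gap X v i j with hgv
  set yd : ℝ → ι → E := fun δ => y + (δ * g / 4) • s with hyd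
  have cyd : Continuous yd := by fun_prop
  have yd0 : yd 0 = y := by simp [hyd]
  have hmem : ∀ᶠ δ in 𝓝[>] (0 : ℝ), (yd δ, v) ∈ Hist X S k := by
    have hc : Continuous fun δ => (yd δ, v) := by fun_prop
    have h0 : (yd 0, v) ∈ Hist X S k := by rwa [yd0]
    exact (hc.continuousAt.eventually_mem ((isOpen_hist X S k).mem_nhds h0)).filter_mono
      nhdsWithin_le_nhds
  have hlt : ∀ᶠ δ in 𝓝[>] (0 : ℝ), δ < τ :=
    (eventually_lt_nhds hτ).filter_mono nhdsWithin_le_nhds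
  have cen : Continuous fun δ : ℝ => yd δ + (τ - δ) • v := by fun_prop
  have hothers : ∀ᶠ δ in 𝓝[>] (0 : ℝ), ∀ a ∈ S, ∀ b ∈ S, Touch X a b → ¬(a = i ∧ b = j) →
      ¬(a = j ∧ b = i) → 0 < gap X (yd δ + (τ - δ) • v) a b := by
    rw [Finset.eventually_all]
    intro a ha
    rw [Finset.eventually_all]
    intro b hb
    by_cases hc : Touch X a b ∧ ¬(a = i ∧ b = j) ∧ ¬(a = j ∧ b = i)
    · rcases ho a ha b hb hc.1 hc.2.1 hc.2.2 with h1 | ⟨hai, hbi, h1⟩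
      · have : Continuous fun δ : ℝ => gap X (yd δ + (τ - δ) • v) a b :=
          (continuous_gap X a b).comp cen
        have h0 : 0 < gap X (yd 0 + (τ - 0) • v) a b := by rwa [yd0, sub_zero]
        filter_upwards [(this.continuousAt.eventually_const_lt h0).filter_mono
          nhdsWithin_le_nhds] with δ hδ _ _ _
        exact hδ
      · filter_upwards [hlt, self_mem_nhdsWithin] with δ hδ hδ0 _ _ _
        rw [mem_Ioi] at hδ0
        have h2 := h.1 a ha b hb hc.1
        simp only [hyd, gap_add, gap_smul, hs, gap_single_of_ne X _ hai hbi] at h1 h2 ⊢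
        have h3 : 0 < τ * (gap X y a b + δ * g / 4 * 0 + (τ - δ) * gap X v a b) := by
          have : 0 ≤ (τ - δ) * (gap X y a b + τ * gap X v a b) :=
            mul_nonneg (by linarith) h1
          have := mul_pos hδ0 h2
          nlinarith
        exact pos_of_mul_pos_right h3 hτ.le
    · exact Eventually.of_forall fun _ h1 h2 h3 => absurd ⟨h1, h2, h3⟩ hc
  have key : ∀ᶠ δ in 𝓝[>] (0 : ℝ),
      (yd δ + (τ - δ) • v, w) ∈ closure (Hist X S (k + 1) ∩ {z | z.2 = w}) := by
    filter_upwards [hmem, hlt, hothers] with δ h1 h2 h3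
    have h4 : gap X (yd δ + (τ - δ) • v) i j = 0 := by
      simp only [hyd, gap_add, gap_smul, hs, gap_single hij] at hg ⊢
      linear_combination hg
    have h5 := Hist.step h1 hX hi hj hij (sub_pos.2 h2) h4 hv h3
    have hc : Continuous fun σ : ℝ => (yd δ + (τ - δ) • v + σ • w, w) := by fun_prop
    have ht := (hc.tendsto 0).mono_left (nhdsWithin_le_nhds (s := Ioi 0))
    simp only [zero_smul, add_zero] at ht
    exact mem_closure_of_tendsto ht (h5.mono fun σ hσ => ⟨hσ, rfl⟩)
  have hc : Continuous fun δ : ℝ => (yd δ + (τ - δ) • v, w) := by fun_prop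
  have ht := (hc.tendsto 0).mono_left (nhdsWithin_le_nhds (s := Ioi 0))
  simp only [yd0, sub_zero] at ht
  simpa using mem_closure_of_tendsto ht key

theorem gap_bounce_of_ne {X : ι → E} {i j a b : ι} (h : a ≠ i ∧ a ≠ j ∧ b ≠ i ∧ b ≠ j)
    (v : ι → E) : gap X (bounce X i j v) a b = gap X v a b := by
  rw [gap, bounce, hit_of_ne _ h.1 h.2.1, hit_of_ne _ h.2.2.1 h.2.2.2, gap]

/-- No touching pair has zero gap and zero rate of change, and no two touching pairs with a
common ball have zero gap. -/
structure Regular (X : ι → E) (S : Finset ι) (y v : ι → E) : Prop where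
  rate_ne : ∀ a ∈ S, ∀ b ∈ S, Touch X a b → gap X y a b = 0 → gap X v a b ≠ 0
  unique : ∀ a ∈ S, ∀ b ∈ S, ∀ c ∈ S, Touch X a b → Touch X a c → gap X y a b = 0 →
    gap X y a c = 0 → b = c

theorem gap_nonneg_of_mem_closure {X : ι → E} {S : Finset ι} {k : ℕ} {y v : ι → E}
    {A : Set ((ι → E) × (ι → E))} (h : (y, v) ∈ closure (Hist X S k ∩ A)) {a b : ι}
    (ha : a ∈ S) (hb : b ∈ S) (hab : Touch X a b) : 0 ≤ gap X y a b := by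
  have hc : IsClosed {z : (ι → E) × (ι → E) | 0 ≤ gap X z.1 a b} :=
    isClosed_le continuous_const ((continuous_gap X a b).comp continuous_fst)
  exact hc.closure_subset_iff.2 (fun z hz => (hz.1.1 a ha b hb hab).le) h

/-- From a limit state in which the approaching touching pairs are pairwise disjoint, one of
these pairs can be made to collide next. -/
theorem advance {X : ι → E} {S : Finset ι} {k : ℕ} {Q : Set (ι → E)} {y v : ι → E}
    (h : (y, v) ∈ closure (Hist X S k ∩ {z | z.2 ∈ Q}))
    (hX : ∀ a ∈ S, ∀ b ∈ S, a ≠ b → 2 ≤ ‖X a - X b‖) (hr : Regular X S y v)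
    (hd : ∀ a ∈ S, ∀ b ∈ S, ∀ c ∈ S, Touch X a b → Touch X a c → gap X v a b < 0 →
      gap X v a c < 0 → b = c)
    (hne : ∃ a ∈ S, ∃ b ∈ S, Touch X a b ∧ gap X v a b < 0) :
    ∃ i ∈ S, ∃ j ∈ S, Touch X i j ∧ gap X v i j < 0 ∧ ∃ y',
      (y', bounce X i j v) ∈ closure (Hist X S (k + 1) ∩ {z | bounce X i j z.2 ∈ Q}) ∧
      Regular X S y' (bounce X i j v) := by
  classical
  set P := (S ×ˢ S).filter fun e => Touch X e.1 e.2 ∧ gap X v e.1 e.2 < 0 with hP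
  have memP : ∀ {e : ι × ι}, e ∈ P ↔
      (e.1 ∈ S ∧ e.2 ∈ S) ∧ Touch X e.1 e.2 ∧ gap X v e.1 e.2 < 0 := by
    intro e; rw [hP, Finset.mem_filter, Finset.mem_product]
  have Pne : P.Nonempty := by
    obtain ⟨a, ha, b, hb, h1⟩ := hne
    exact ⟨(a, b), memP.2 ⟨⟨ha, hb⟩, h1⟩⟩
  set t : (ι → E) × (ι → E) → ι × ι → ℝ :=
    fun z e => gap X z.1 e.1 e.2 / (-gap X z.2 e.1 e.2) with ht
  obtain ⟨e₀, he₀, hmin⟩ := P.exists_min_image (t (y, v)) Pne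
  set τ := t (y, v) e₀ with hτ
  have hgap0 : ∀ {a b}, a ∈ S → b ∈ S → Touch X a b → 0 ≤ gap X y a b :=
    fun ha hb hab => gap_nonneg_of_mem_closure h ha hb hab
  have hτ0 : 0 ≤ τ := by
    obtain ⟨⟨h1, h2⟩, h3, h4⟩ := memP.1 he₀
    exact div_nonneg (hgap0 h1 h2 h3) (by linarith)
  set D := P.filter fun e => t (y, v) e = τ with hD
  have memD : ∀ {e : ι × ι}, e ∈ D ↔ e ∈ P ∧ t (y, v) e = τ := by
    intro e; rw [hD, Finset.mem_filter]
  have Dne : D.Nonempty := ⟨e₀, memD.2 ⟨he₀, rfl⟩⟩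
  set y' := y + τ • v with hy'
  have hzero : ∀ {e : ι × ι}, e ∈ P → t (y, v) e = τ → gap X y' e.1 e.2 = 0 := by
    intro e he het
    have h1 := (memP.1 he).2.2
    simp only [ht] at het
    rw [hy', gap_add, gap_smul, ← het]
    exact add_div_neg_mul h1.ne
  have hpos : ∀ {e : ι × ι}, e ∈ P → e ∉ D → 0 < gap X y' e.1 e.2 := by
    intro e he heD
    have h1 := (memP.1 he).2.2
    have h2 : τ < t (y, v) e := lt_of_le_of_ne (hmin e he) fun h => heD (memD.2 ⟨he, h.symm⟩)
    simp only [ht] at h2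
    rw [lt_div_iff₀ (by linarith)] at h2
    rw [hy', gap_add, gap_smul]
    linarith
  have tcont : ∀ e ∈ P, Tendsto (fun z => t z e) (𝓝 (y, v)) (𝓝 (t (y, v) e)) := by
    intro e he
    have h1 := (memP.1 he).2.2
    have c1 := ((continuous_gap X e.1 e.2).comp continuous_fst).tendsto (y, v)
    have c2 := ((continuous_gap X e.1 e.2).comp continuous_snd).tendsto (y, v)
    exact c1.div c2.neg (neg_ne_zero.2 h1.ne)
  set Ψ : ι × ι → (ι → E) × (ι → E) → (ι → E) × (ι → E) :=
    fun e z => (z.1 + t z e • z.2, bounce X e.1 e.2 z.2) with hΨ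
  have Ψcont : ∀ e ∈ D, Tendsto (Ψ e) (𝓝 (y, v)) (𝓝 (y', bounce X e.1 e.2 v)) := by
    intro e he
    have h1 := tcont e (memD.1 he).1
    rw [(memD.1 he).2] at h1
    refine Tendsto.prodMk_nhds ?_ ?_
    · exact (continuous_fst.tendsto (y, v)).add (h1.smul (continuous_snd.tendsto (y, v)))
    · exact tendsto_hit tendsto_const_nhds (continuous_snd.tendsto (y, v)) _ _
  have hclosing : ∀ᶠ z in 𝓝 (y, v), ∀ e ∈ D, gap X z.2 e.1 e.2 < 0 := by
    rw [Finset.eventually_all]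
    intro e he
    have c2 : Continuous fun z : (ι → E) × (ι → E) => gap X z.2 e.1 e.2 :=
      (continuous_gap X e.1 e.2).comp continuous_snd
    exact c2.continuousAt.eventually_lt_const (memP.1 (memD.1 he).1).2.2
  have hother : ∀ᶠ z in 𝓝 (y, v), ∀ e ∈ D, ∀ a ∈ S, ∀ b ∈ S, Touch X a b → (a, b) ∉ D →
      (0 < gap X (z.1 + t z e • z.2) a b ∨ 0 < gap X z.2 a b) := by
    rw [Finset.eventually_all]
    intro e he
    rw [Finset.eventually_all]
    intro a ha
    rw [Finset.eventually_all]
    intro b hb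
    by_cases hc : Touch X a b ∧ (a, b) ∉ D
    swap
    · exact Eventually.of_forall fun _ h1 h2 => absurd ⟨h1, h2⟩ hc
    by_cases h0 : 0 < gap X y' a b
    · have c1 := ((continuous_gap X a b).tendsto y').comp
        ((continuous_fst.tendsto _).comp (Ψcont e he))
      filter_upwards [c1.eventually_const_lt h0] with z hz _ _
      exact Or.inl hz
    · have h1 : 0 < gap X v a b := by
        by_contra hcon
        have h2 : (a, b) ∉ P := fun hp => h0 (hpos hp hc.2)
        have h3 : gap X v a b = 0 := by
          refine le_antisymm (not_lt.1 hcon) (not_lt.1 fun h3 => h2 (memP.2 ⟨⟨ha, hb⟩, hc.1, h3⟩))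
        have h4 : gap X y a b = 0 := by
          refine le_antisymm ?_ (hgap0 ha hb hc.1)
          rw [hy', gap_add, gap_smul, h3] at h0
          linarith
        exact hr.rate_ne a ha b hb hc.1 h4 h3
      have c2 : Continuous fun z : (ι → E) × (ι → E) => gap X z.2 a b :=
        (continuous_gap X a b).comp continuous_snd
      filter_upwards [c2.continuousAt.eventually_const_lt h1] with z hz _ _
      exact Or.inr hz
  have disj : ∀ {e f : ι × ι}, e ∈ P → f ∈ P → ¬(f.1 = e.1 ∧ f.2 = e.2) →
      ¬(f.1 = e.2 ∧ f.2 = e.1) → f.1 ≠ e.1 ∧ f.1 ≠ e.2 ∧ f.2 ≠ e.1 ∧ f.2 ≠ e.2 := by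
    rintro ⟨a, b⟩ ⟨c, d⟩ he hf h1 h2
    obtain ⟨⟨ha, hb⟩, hab, hgab⟩ := memP.1 he
    obtain ⟨⟨hc', hd'⟩, hcd, hgcd⟩ := memP.1 hf
    simp only at *
    refine ⟨?_, ?_, ?_, ?_⟩
    · rintro rfl
      exact h1 ⟨rfl, hd _ hc' _ hd' _ hb hcd hab hgcd hgab⟩
    · rintro rfl
      exact h2 ⟨rfl, hd _ hc' _ hd' _ ha hcd hab.symm hgcd (by rwa [gap_swap])⟩
    · rintro rfl
      exact h2 ⟨hd _ hd' _ hc' _ hb hcd.symm hab (by rwa [gap_swap]) hgab, rfl⟩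
    · rintro rfl
      exact h1 ⟨hd _ hd' _ hc' _ ha hcd.symm hab.symm (by rwa [gap_swap]) (by rwa [gap_swap]), rfl⟩
  have hnear : ∀ᶠ z in 𝓝 (y, v), z ∈ Hist X S k ∩ {z | z.2 ∈ Q} → ∃ e ∈ D,
      Ψ e z ∈ closure (Hist X S (k + 1) ∩ {z | bounce X e.1 e.2 z.2 ∈ Q}) := by
    filter_upwards [hclosing, hother] with z h1 h2 hz
    obtain ⟨e, he, hemin⟩ := D.exists_min_image (t z) Dne
    obtain ⟨⟨hi, hj⟩, hij, -⟩ := memP.1 (memD.1 he).1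
    have hge := hz.1.1 _ hi _ hj hij
    have hve := h1 e he
    have hte : 0 < t z e := div_pos hge (by linarith)
    have hg : gap X (z.1 + t z e • z.2) e.1 e.2 = 0 := by
      rw [gap_add, gap_smul]
      exact add_div_neg_mul hve.ne
    refine ⟨e, he, closure_mono ?_ (Hist.step_closure hz.1 hX hi hj hij hte hg hve ?_)⟩
    · rintro q ⟨hq1, hq2⟩
      refine ⟨hq1, ?_⟩
      rw [mem_ofPred_eq] at hq2 ⊢
      rw [hq2, bounce_bounce hij]
      exact hz.2
    · intro a ha b hb hab n1 n2
      by_cases hf : (a, b) ∈ D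
      · right
        have h3 := disj (memD.1 he).1 (memD.1 hf).1 n1 n2
        refine ⟨h3.1, h3.2.2.1, ?_⟩
        have h4 := hemin _ hf
        have h5 := h1 _ hf
        have h6 : t z e * (-gap X z.2 a b) ≤ gap X z.1 a b :=
          (le_div_iff₀ (by simpa using h5)).1 h4
        rw [gap_add, gap_smul]
        linarith
      · left
        rcases h2 e he a ha b hb hab hf with h3 | h3
        · exact h3
        · have := hz.1.1 a ha b hb hab
          have := mul_pos hte h3
          rw [gap_add, gap_smul]
          linarith
  have hex : ∃ e ∈ D, ∃ᶠ z in 𝓝 (y, v),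
      Ψ e z ∈ closure (Hist X S (k + 1) ∩ {z | bounce X e.1 e.2 z.2 ∈ Q}) := by
    by_contra! hcon
    have h1 := (Finset.eventually_all D).2 hcon
    have h2 := (mem_closure_iff_frequently.1 h).and_eventually (h1.and hnear)
    obtain ⟨z, hzA, hz1, hz2⟩ := h2.exists
    obtain ⟨e, he, hz3⟩ := hz2 hzA
    exact hz1 e he hz3
  obtain ⟨e, he, hfr⟩ := hex
  obtain ⟨⟨hi, hj⟩, hij, hve⟩ := memP.1 (memD.1 he).1
  have hcl : ∀ {a b}, a ∈ S → b ∈ S → Touch X a b → gap X y' a b = 0 →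
      (gap X v a b < 0 ∨ (gap X y a b = 0 ∧ τ = 0)) := by
    intro a b ha hb hab h0
    rcases hτ0.eq_or_lt with h1 | h1
    · right
      rw [hy', ← h1] at h0
      exact ⟨by simpa using h0, h1.symm⟩
    · left
      rw [hy', gap_add, gap_smul] at h0
      have h2 := hgap0 ha hb hab
      by_contra hcon
      have h3 : 0 ≤ τ * gap X v a b := mul_nonneg hτ0 (not_lt.1 hcon)
      have h4 : gap X y a b = 0 := by linarith
      have h5 : τ * gap X v a b = 0 := by linarith
      rcases mul_eq_zero.1 h5 with h6 | h6
      · exact h1.ne' h6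
      · exact hr.rate_ne a ha b hb hab h4 h6
  have huniq : ∀ a ∈ S, ∀ b ∈ S, ∀ c ∈ S, Touch X a b → Touch X a c → gap X y' a b = 0 →
      gap X y' a c = 0 → b = c := by
    intro a ha b hb c hc hab hac h1 h2
    rcases hτ0.eq_or_lt with h3 | h3
    · rw [hy', ← h3] at h1 h2
      exact hr.unique a ha b hb c hc hab hac (by simpa using h1) (by simpa using h2)
    · rcases hcl ha hb hab h1 with h4 | h4
      · rcases hcl ha hc hac h2 with h5 | h5
        · exact hd a ha b hb c hc hab hac h4 h5
        · exact absurd h5.2 h3.ne'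
      · exact absurd h4.2 h3.ne'
  refine ⟨e.1, hi, e.2, hj, hij, hve, y', ?_, ?_, huniq⟩
  · simpa using mem_closure_of_frequently_of_tendsto hfr (Ψcont e he)
  · have he0 := hzero (memD.1 he).1 (memD.1 he).2
    intro a ha b hb hab h0
    by_cases h1 : a = e.1 ∧ b = e.2
    · rw [h1.1, h1.2, gap_bounce hij]
      linarith
    by_cases h2 : a = e.2 ∧ b = e.1
    · rw [h2.1, h2.2, gap_swap, gap_bounce hij]
      linarith
    have h3 : a ≠ e.1 ∧ a ≠ e.2 ∧ b ≠ e.1 ∧ b ≠ e.2 := by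
      refine ⟨?_, ?_, ?_, ?_⟩
      · rintro rfl
        exact h1 ⟨rfl, huniq _ ha _ hb _ hj hab hij h0 he0⟩
      · rintro rfl
        exact h2 ⟨rfl, huniq _ ha _ hb _ hi hab hij.symm h0 (by rwa [gap_swap])⟩
      · rintro rfl
        exact h2 ⟨huniq _ hb _ ha _ hj hab.symm hij (by rwa [gap_swap]) he0, rfl⟩
      · rintro rfl
        exact h1 ⟨huniq _ hb _ ha _ hi hab.symm hij.symm (by rwa [gap_swap]) (by rwa [gap_swap]),
          rfl⟩
    rw [gap_bounce_of_ne h3]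
    rcases hcl ha hb hab h0 with h4 | h4
    · exact h4.ne
    · exact hr.rate_ne a ha b hb hab h4.1

end

section

variable {ι : Type} {E : Type*} [NormedAddCommGroup E] [InnerProductSpace ℝ E] [DecidableEq ι]

/-- A ball arriving fast enough in free flight can be added to a motion. -/
theorem Past.insert_ball {S : Finset ι} {k : ℕ} {M : ℝ} {p v : ι → E} (h : Past S k M p v) {j : ι}
    (hj : j ∉ S) (X : ι → E)
    (hp : ∀ i ∈ S, 2 * ‖X j - X i‖ < ⟪X j - X i, p j - p i⟫)
    (hv : ∀ i ∈ S, M * ‖X j - X i‖ ≤ -⟪X j - X i, v j⟫) :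
    Past (insert j S) k (max M ‖v j‖) p v := by
  obtain ⟨x, vl, vr, F, h⟩ := h
  have ne : ∀ {i}, i ∈ S → i ≠ j := fun hi hij => hj (hij ▸ hi)
  set x' : ι → ℝ → E := fun i t => if i = j then p j + t • v j else x i t with hx'
  set vl' : ι → ℝ → E := fun i t => if i = j then v j else vl i t with hvl'
  set vr' : ι → ℝ → E := fun i t => if i = j then v j else vr i t with hvr'
  have x1 : ∀ t, x' j t = p j + t • v j := fun t => by simp [hx']
  have l1 : ∀ t, vl' j t = v j := fun t => by simp [hvl']
  have r1 : ∀ t, vr' j t = v j := fun t => by simp [hvr']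
  have x2 : ∀ {i}, i ∈ S → ∀ t, x' i t = x i t := fun hi t => by simp [hx', ne hi]
  have l2 : ∀ {i}, i ∈ S → ∀ t, vl' i t = vl i t := fun hi t => by simp [hvl', ne hi]
  have r2 : ∀ {i}, i ∈ S → ∀ t, vr' i t = vr i t := fun hi t => by simp [hvr', ne hi]
  have far : ∀ i ∈ S, ∀ t ≤ 0, 2 < ‖x' j t - x' i t‖ := by
    intro i hi t ht
    refine lt_norm_of_inner (w := X j - X i) ?_
    have e : x' j t - x' i t = (p j - p i) + t • v j - (x i t - p i) := by
      rw [x1, x2 hi]; abel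
    have h1 := (real_inner_le_norm (X j - X i) (x i t - p i)).trans
      (mul_le_mul_of_nonneg_left (h.speed i hi t ht) (norm_nonneg _))
    have h2 := mul_le_mul_of_nonneg_left (hv i hi) (neg_nonneg.2 ht)
    have h3 := hp i hi
    rw [e, inner_sub_right, inner_add_right, real_inner_smul_right]
    nlinarith
  refine ⟨x', vl', vr', F, ?_, ?_, ?_, ?_, ?_, ?_, ?_, h.card_le, ?_⟩
  · intro i hi
    rcases Finset.mem_insert.1 hi with rfl | hi
    · simp [x1]
    · rw [x2 hi, h.pos_zero i hi]
  · intro i hi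
    rcases Finset.mem_insert.1 hi with rfl | hi
    · rw [l1]
    · rw [l2 hi, h.vel_zero i hi]
  · intro i hi t ht
    rcases Finset.mem_insert.1 hi with rfl | hi
    · refine ⟨1, one_pos, fun s _ => ?_⟩
      rw [x1, x1, r1]
      module
    · simp only [x2 hi, r2 hi]
      exact h.right_lin i hi t ht
  · intro i hi t ht
    rcases Finset.mem_insert.1 hi with rfl | hi
    · refine ⟨1, one_pos, fun s _ => ?_⟩
      rw [x1, x1, l1]
      module
    · simp only [x2 hi, l2 hi]
      exact h.left_lin i hi t ht
  · intro a ha b hb hab t ht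
    rcases Finset.mem_insert.1 ha with rfl | ha' <;> rcases Finset.mem_insert.1 hb with rfl | hb'
    · exact absurd rfl hab
    · exact (far b hb' t ht).le
    · rw [norm_sub_rev]
      exact (far a ha' t ht).le
    · rw [x2 ha', x2 hb']
      exact h.dist_ge a ha' b hb' hab t ht
  · intro t ht i hi hne
    rcases Finset.mem_insert.1 hi with rfl | hi
    · exact absurd ((r1 t).trans (l1 t).symm) hne
    · simp only [r2 hi, l2 hi] at hne
      obtain ⟨k, hk, h1, h2, h3, h4, h5, h6, h7⟩ := h.rule t ht i hi hne
      have hfar := far i hi t ht.le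
      refine ⟨k, Finset.mem_insert_of_mem hk, h1, ?_, ?_, ?_, ?_, ?_, ?_⟩
      · simpa only [x2 hi, x2 hk] using h2
      · simpa only [r2 hk, l2 hk] using h3
      · intro m hm hmi hm2
        rcases Finset.mem_insert.1 hm with rfl | hm
        · rw [norm_sub_rev] at hfar
          exact absurd hm2 hfar.ne'
        · simp only [x2 hi, x2 hm] at hm2
          exact h4 m hm hmi hm2
      · intro m hm hmi hmk
        rcases Finset.mem_insert.1 hm with rfl | hm
        · exact (r1 t).trans (l1 t).symm
        · simp only [r2 hm, l2 hm]
          exact h5 m hm hmi hmk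
      · simpa only [r2 hi, l2 hi, l2 hk, x2 hi, x2 hk] using h6
      · simpa only [r2 hk, l2 hi, l2 hk, x2 hi, x2 hk] using h7
  · intro q hq
    obtain ⟨h0, a, ha, b, hb, hab, h1, h2, h3, h4⟩ := h.coll q hq
    refine ⟨h0, a, Finset.mem_insert_of_mem ha, b, Finset.mem_insert_of_mem hb, hab, h1, ?_, ?_, ?_⟩
    · rwa [x2 ha, x2 hb]
    · rwa [r2 ha, l2 ha]
    · rwa [r2 hb, l2 hb]
  · intro i hi t ht
    rcases Finset.mem_insert.1 hi with rfl | hi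
    · rw [x1, add_sub_cancel_left, norm_smul, Real.norm_of_nonpos ht, mul_comm]
      exact mul_le_mul_of_nonneg_right (le_max_right _ _) (by linarith)
    · rw [x2 hi]
      exact (h.speed i hi t ht).trans
        (mul_le_mul_of_nonneg_right (le_max_left _ _) (by linarith))

theorem Hist.insert_slow {X : ι → E} {S : Finset ι} {k : ℕ} {y v : ι → E}
    (h : (y, v) ∈ Hist X S k) {j : ι} (hj : j ∉ S) (hX : ∀ i ∈ S, 2 ≤ ‖X j - X i‖) {e w : E}
    (he : ∀ i ∈ S, 0 < ⟪X j - X i, e⟫)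
    (hw : ∀ i ∈ S, 0 < ⟪X j - X i, w - y i⟫) :
    ∀ᶠ c in 𝓝[>] (0 : ℝ),
      (Function.update y j w, Function.update (c • v) j (-e)) ∈ Hist X (insert j S) k := by
  have ne : ∀ {i}, i ∈ S → i ≠ j := fun hi hij => hj (hij ▸ hi)
  have hgap : ∀ i ∈ S, 0 < gap X (Function.update y j w) j i := by
    intro i hi
    simpa [gap, ne hi] using hw i hi
  obtain ⟨h1, M, hM⟩ := h
  have hsmall : ∀ᶠ c in 𝓝[>] (0 : ℝ), ∀ i ∈ S, c * M * ‖X j - X i‖ < ⟪X j - X i, e⟫ := by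
    rw [Finset.eventually_all]
    intro i hi
    have hc : Continuous fun c : ℝ => c * M * ‖X j - X i‖ := by fun_prop
    exact (hc.continuousAt.eventually_lt_const (by simpa using he i hi)).filter_mono
      nhdsWithin_le_nhds
  filter_upwards [hsmall, self_mem_nhdsWithin] with c hc hc0
  set z : (ι → E) × (ι → E) := (Function.update y j w, Function.update (c • v) j (-e)) with hz
  have hp : NearPast X S k (c * M) z := by
    refine (hM.smul hc0).congr (fun i hi => ?_) (fun i hi => ?_)
    · exact Function.update_of_ne (ne hi) _ _
    · exact Function.update_of_ne (ne hi) _ _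
  refine ⟨?_, max (c * M) (‖e‖ + 1), ?_⟩
  · intro a ha b hb hab
    rcases Finset.mem_insert.1 ha with rfl | ha' <;> rcases Finset.mem_insert.1 hb with rfl | hb'
    · exact absurd rfl hab.1
    · exact hgap b hb'
    · rw [gap_swap]
      exact hgap a ha'
    · have := h1 a ha' b hb' hab
      simpa [gap, hz, ne ha', ne hb'] using this
  · set l : Filter (ℝ × (ι → E) × (ι → E)) := 𝓝[>] (0 : ℝ) ×ˢ 𝓝 z with hl
    have t0 : Tendsto (fun q : ℝ × (ι → E) × (ι → E) => q.1) l (𝓝[>] 0) := tendsto_fst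
    have t1 : Tendsto (fun q : ℝ × (ι → E) × (ι → E) => q.2.1) l (𝓝 z.1) :=
      (continuous_fst.tendsto z).comp tendsto_snd
    have t2 : Tendsto (fun q : ℝ × (ι → E) × (ι → E) => q.2.2) l (𝓝 z.2) :=
      (continuous_snd.tendsto z).comp tendsto_snd
    have t2j := (tendsto_pi_nhds.1 t2) j
    have hzj : z.2 j = -e := by simp [hz]
    rw [hzj] at t2j
    have e1 : ∀ᶠ q in l, ∀ i ∈ S,
        2 * ‖X j - X i‖ < ⟪X j - X i, (X + q.1 • q.2.1) j - (X + q.1 • q.2.1) i⟫ := by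
      rw [Finset.eventually_all]
      exact fun i hi => eventually_clear (hX i hi) (fun _ => hgap i hi) t0 t1
    have e2 : ∀ᶠ q in l, ∀ i ∈ S, c * M * ‖X j - X i‖ < -⟪X j - X i, q.2.2 j⟫ := by
      rw [Finset.eventually_all]
      intro i hi
      have := ((tendsto_const_nhds (x := X j - X i)).inner (𝕜 := ℝ) t2j).neg
      refine this.eventually_const_lt ?_
      rw [inner_neg_right, neg_neg]
      exact hc i hi
    have e3 : ∀ᶠ q in l, ‖q.2.2 j‖ < ‖e‖ + 1 :=
      t2j.norm.eventually_lt_const (by rw [norm_neg]; linarith)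
    filter_upwards [hp, e1, e2, e3] with q h2 h3 h4 h5
    exact (h2.insert_ball hj X h3 fun i hi => (h4 i hi).le).mono (max_le_max le_rfl h5.le)

/-- After slowing down, a further ball moving in the direction `-e` can be added; in the limit
all other balls are at rest. -/
theorem Hist.exists_insert {X : ι → E} {S : Finset ι} {k : ℕ} {y v : ι → E}
    (h : (y, v) ∈ Hist X S k) {j : ι} (hj : j ∉ S) (hX : ∀ i ∈ S, 2 ≤ ‖X j - X i‖) {e d : E}
    (he : ∀ s > (0 : ℝ), ∀ i ∈ S, 0 < ⟪X j - X i, e + s • d⟫) :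
    ∃ y', (y', Pi.single j (-e)) ∈
        closure (Hist X (insert j S) k ∩ {z | ∃ c > (0 : ℝ), ∀ i ∈ S, z.2 i = c • v i}) ∧
      ∀ w, Regular X (insert j S) y' w := by
  have ne : ∀ {i}, i ∈ S → i ≠ j := fun hi hij => hj (hij ▸ hi)
  set f := e + (1 : ℝ) • d with hf
  obtain ⟨L, hL⟩ := exists_bound S fun i => ⟪X j - X i, y i⟫ / ⟪X j - X i, f⟫
  have hw : ∀ i ∈ S, 0 < ⟪X j - X i, L • f - y i⟫ := by
    intro i hi
    have := (div_lt_iff₀ (he 1 one_pos i hi)).1 (hL i hi)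
    rw [inner_sub_right, real_inner_smul_right]
    linarith
  set y' := Function.update y j (L • f) with hy'
  set B := Hist X (insert j S) k ∩ {z | ∃ c > (0 : ℝ), ∀ i ∈ S, z.2 i = c • v i} with hB
  have h1 : ∀ s > (0 : ℝ), (y', Pi.single j (-(e + s • d))) ∈ closure B := by
    intro s hs
    have hc : Continuous fun c : ℝ => (y', Function.update (c • v) j (-(e + s • d))) := by
      refine continuous_const.prodMk (Continuous.update (by fun_prop) _ continuous_const)
    have ht := (hc.tendsto 0).mono_left (nhdsWithin_le_nhds (s := Ioi 0))
    rw [zero_smul] at ht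
    refine mem_closure_of_tendsto ht ?_
    filter_upwards [Hist.insert_slow h hj hX (he s hs) hw, self_mem_nhdsWithin] with c h2 h3
    exact ⟨h2, c, h3, fun i hi => Function.update_of_ne (ne hi) _ _⟩
  refine ⟨y', ?_, fun w => ?_⟩
  · have hc : Continuous fun s : ℝ => (y', (Pi.single j (-(e + s • d)) : ι → E)) :=
      continuous_const.prodMk ((continuous_single j).comp (by fun_prop))
    have ht := (hc.tendsto 0).mono_left (nhdsWithin_le_nhds (s := Ioi 0))
    rw [zero_smul, add_zero] at ht
    rw [← closure_closure]
    refine mem_closure_of_tendsto ht ?_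
    filter_upwards [self_mem_nhdsWithin] with s hs
    exact h1 s hs
  · obtain ⟨c, hc⟩ := (Hist.insert_slow h hj hX (he 1 one_pos) hw).exists
    have hpos := hc.1
    exact ⟨fun a ha b hb hab h0 => absurd h0 (hpos a ha b hb hab).ne',
      fun a ha b hb _ _ hab _ h0 => absurd h0 (hpos a ha b hb hab).ne'⟩

end

section

variable {E : Type*} [NormedAddCommGroup E] [InnerProductSpace ℝ E]

/-- The directions of the three rows of balls. -/
structure Frame (e : Fin 3 → E) : Prop where
  inner_self : ∀ r, ⟪e r, e r⟫ = 1
  inner_zero_one : ⟪e 0, e 1⟫ = -(3 / 5)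
  inner_zero_two : ⟪e 0, e 2⟫ = -(4 / 5)
  inner_one_two : ⟪e 1, e 2⟫ = 0
  eq_two : e 2 = -(5 / 4 : ℝ) • e 0 - (3 / 4 : ℝ) • e 1

theorem Frame.inner_nonpos {e : Fin 3 → E} (h : Frame e) {r s : Fin 3} (hrs : r ≠ s) :
    ⟪e r, e s⟫ ≤ 0 := by
  have h1 := h.inner_zero_one
  have h2 := h.inner_zero_two
  have h3 := h.inner_one_two
  fin_cases r <;> fin_cases s <;> first | exact absurd rfl hrs | skip
  all_goals simp only [Fin.zero_eta, Fin.mk_one, Fin.reduceFinMk]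
  · linarith
  · linarith
  · rw [real_inner_comm]; linarith
  · linarith
  · rw [real_inner_comm]; linarith
  · rw [real_inner_comm]; linarith

/-- The reference positions: row `r` consists of the points `2 i e_r`. -/
noncomputable def pos (e : Fin 3 → E) (p : Fin 3 × ℕ) : E := (2 * p.2 : ℝ) • e p.1

/-- The labels of actual balls: the central ball is counted in the last row only. -/
def IsBall (p : Fin 3 × ℕ) : Prop := p.1 = 2 ∨ 1 ≤ p.2

/-- Neighbouring labels. -/
def Nb (p q : Fin 3 × ℕ) : Prop :=
  (p.1 = q.1 ∧ (p.2 + 1 = q.2 ∨ q.2 + 1 = p.2)) ∨ (p = (2, 0) ∧ q.2 = 1) ∨ (q = (2, 0) ∧ p.2 = 1)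

theorem norm_pos_sub_sq {e : Fin 3 → E} (h : Frame e) (p q : Fin 3 × ℕ) :
    ‖pos e p - pos e q‖ ^ 2 = 4 * (p.2 ^ 2 + q.2 ^ 2 - 2 * p.2 * q.2 * ⟪e p.1, e q.1⟫) := by
  rw [← real_inner_self_eq_norm_sq, pos, pos]
  simp only [inner_sub_left, inner_sub_right, real_inner_smul_left, real_inner_smul_right,
    h.inner_self, real_inner_comm (e p.1) (e q.1)]
  ring

theorem norm_pos_sub_row {e : Fin 3 → E} (h : Frame e) (r : Fin 3) (i j : ℕ) :
    ‖pos e (r, i) - pos e (r, j)‖ = 2 * |(i : ℝ) - j| := by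
  refine (sq_eq_sq₀ (norm_nonneg _) (by positivity)).1 ?_
  rw [norm_pos_sub_sq h, mul_pow, sq_abs, h.inner_self]
  ring

theorem norm_pos_sub_center {e : Fin 3 → E} (h : Frame e) (q : Fin 3 × ℕ) :
    ‖pos e (2, 0) - pos e q‖ = 2 * q.2 := by
  refine (sq_eq_sq₀ (norm_nonneg _) (by positivity)).1 ?_
  rw [norm_pos_sub_sq h]
  push_cast
  ring

theorem two_lt_norm_pos_sub {e : Fin 3 → E} (h : Frame e) {p q : Fin 3 × ℕ} (hpq : p.1 ≠ q.1)
    (hp : 1 ≤ p.2) (hq : 1 ≤ q.2) : 2 < ‖pos e p - pos e q‖ := by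
  have h1 := norm_pos_sub_sq h p q
  have h2 : (1 : ℝ) ≤ p.2 := by exact_mod_cast hp
  have h3 : (1 : ℝ) ≤ q.2 := by exact_mod_cast hq
  have h4 : 0 ≤ 2 * (p.2 : ℝ) * q.2 * -⟪e p.1, e q.1⟫ :=
    mul_nonneg (by positivity) (neg_nonneg.2 (h.inner_nonpos hpq))
  refine lt_of_pow_lt_pow_left₀ 2 (norm_nonneg _) ?_
  nlinarith

theorem one_le_abs_sub {i j : ℕ} (h : i ≠ j) : 1 ≤ |(i : ℝ) - j| := by
  have h1 : (1 : ℤ) ≤ |(i : ℤ) - j| := Int.one_le_abs (by omega)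
  exact_mod_cast h1

theorem two_le_norm_pos_sub {e : Fin 3 → E} (h : Frame e) {p q : Fin 3 × ℕ} (hp : IsBall p)
    (hq : IsBall q) (hpq : p ≠ q) : 2 ≤ ‖pos e p - pos e q‖ := by
  obtain ⟨r, i⟩ := p
  obtain ⟨s, j⟩ := q
  by_cases hrs : r = s
  · subst hrs
    have := one_le_abs_sub (i := i) (j := j) (fun h => hpq (by rw [h]))
    rw [norm_pos_sub_row h]
    linarith
  rcases Nat.eq_zero_or_pos i with rfl | hi
  · have hr : r = 2 := by simpa [IsBall] using hp
    have hj : 1 ≤ j := by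
      rcases hq with hq | hq
      · exact absurd (hr.trans hq.symm) hrs
      · exact hq
    have : (1 : ℝ) ≤ j := by exact_mod_cast hj
    rw [hr, norm_pos_sub_center h]
    simp only
    linarith
  rcases Nat.eq_zero_or_pos j with rfl | hj
  · have hs : s = 2 := by simpa [IsBall] using hq
    have : (1 : ℝ) ≤ i := by exact_mod_cast hi
    rw [hs, norm_sub_rev, norm_pos_sub_center h]
    simp only
    linarith
  · exact (two_lt_norm_pos_sub (p := (r, i)) (q := (s, j)) h hrs hi hj).le

theorem touch_iff {e : Fin 3 → E} (h : Frame e) {p q : Fin 3 × ℕ} (hp : IsBall p)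
    (hq : IsBall q) : Touch (pos e) p q ↔ Nb p q := by
  obtain ⟨r, i⟩ := p
  obtain ⟨s, j⟩ := q
  have row : ∀ i j : ℕ, 2 * |(i : ℝ) - j| = 2 ↔ (i + 1 = j ∨ j + 1 = i) := by
    intro i j
    have h1 : 2 * |(i : ℝ) - j| = 2 ↔ |(i : ℝ) - j| = 1 := by constructor <;> intro h <;> linarith
    have h2 : |(i : ℝ) - j| = 1 ↔ |(i : ℤ) - j| = 1 := by
      constructor <;> intro h <;> exact_mod_cast h
    rw [h1, h2, abs_eq one_pos.le]
    omega
  have center : ∀ j : ℕ, (2 * (j : ℝ) = 2 ↔ j = 1) := by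
    intro j
    constructor
    · intro h
      have : (j : ℝ) = 1 := by linarith
      exact_mod_cast this
    · rintro rfl
      norm_num
  constructor
  · rintro ⟨h1, h2⟩
    by_cases hrs : r = s
    · subst hrs
      rw [norm_pos_sub_row h, row] at h2
      exact Or.inl ⟨rfl, h2⟩
    rcases Nat.eq_zero_or_pos i with rfl | hi
    · have hr : r = 2 := by simpa [IsBall] using hp
      rw [hr, norm_pos_sub_center h] at h2
      exact Or.inr (Or.inl ⟨by rw [hr], (center j).1 h2⟩)
    rcases Nat.eq_zero_or_pos j with rfl | hj
    · have hs : s = 2 := by simpa [IsBall] using hq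
      rw [hs, norm_sub_rev, norm_pos_sub_center h] at h2
      exact Or.inr (Or.inr ⟨by rw [hs], (center i).1 h2⟩)
    · exact absurd h2 (two_lt_norm_pos_sub (p := (r, i)) (q := (s, j)) h hrs hi hj).ne'
  · rintro (⟨h1, h2⟩ | ⟨h1, h2⟩ | ⟨h1, h2⟩)
    · simp only at h1 h2
      subst h1
      refine ⟨fun h => ?_, by rw [norm_pos_sub_row h, row]; exact h2⟩
      have := (Prod.mk.inj h).2
      omega
    · simp only at h2
      subst h2
      rw [h1]
      exact ⟨by simp, by rw [norm_pos_sub_center h]; norm_num⟩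
    · simp only at h2
      subst h2
      rw [h1]
      exact ⟨by simp, by rw [norm_sub_rev, norm_pos_sub_center h]; norm_num⟩

/-- The first `a`, `b` balls of the first two rows, and the first `c` balls of the last row. -/
def balls (a b c : ℕ) : Finset (Fin 3 × ℕ) :=
  (Finset.Icc 1 a).image (Prod.mk 0) ∪ (Finset.Icc 1 b).image (Prod.mk 1) ∪
    (Finset.range c).image (Prod.mk 2)

theorem mem_balls {a b c : ℕ} {p : Fin 3 × ℕ} : p ∈ balls a b c ↔
    (p.1 = 0 ∧ 1 ≤ p.2 ∧ p.2 ≤ a) ∨ (p.1 = 1 ∧ 1 ≤ p.2 ∧ p.2 ≤ b) ∨ (p.1 = 2 ∧ p.2 < c) := by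
  obtain ⟨r, i⟩ := p
  simp only [balls, Finset.mem_union, Finset.mem_image, Finset.mem_Icc, Finset.mem_range,
    Prod.mk.injEq]
  constructor
  · rintro ((⟨x, hx, rfl, rfl⟩ | ⟨x, hx, rfl, rfl⟩) | ⟨x, hx, rfl, rfl⟩)
    · exact Or.inl ⟨rfl, hx⟩
    · exact Or.inr (Or.inl ⟨rfl, hx⟩)
    · exact Or.inr (Or.inr ⟨rfl, hx⟩)
  · rintro (⟨rfl, hx⟩ | ⟨rfl, hx⟩ | ⟨rfl, hx⟩)
    · exact Or.inl (Or.inl ⟨i, hx, rfl, rfl⟩)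
    · exact Or.inl (Or.inr ⟨i, hx, rfl, rfl⟩)
    · exact Or.inr ⟨i, hx, rfl, rfl⟩

theorem isBall_of_mem {a b c : ℕ} {p : Fin 3 × ℕ} (h : p ∈ balls a b c) : IsBall p := by
  rcases mem_balls.1 h with h | h | h
  · exact Or.inr h.2.1
  · exact Or.inr h.2.1
  · exact Or.inl h.1

theorem balls_succ_zero (a b c : ℕ) : balls (a + 1) b c = insert (0, a + 1) (balls a b c) := by
  ext ⟨r, i⟩
  simp only [mem_balls, Finset.mem_insert, Prod.mk.injEq]
  constructor
  · rintro (⟨rfl, h1, h2⟩ | h | h)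
    · by_cases h3 : i = a + 1
      · exact Or.inl ⟨rfl, h3⟩
      · exact Or.inr (Or.inl ⟨rfl, h1, by omega⟩)
    · exact Or.inr (Or.inr (Or.inl h))
    · exact Or.inr (Or.inr (Or.inr h))
  · rintro (⟨rfl, rfl⟩ | ⟨rfl, h1, h2⟩ | h | h)
    · exact Or.inl ⟨rfl, by omega, le_rfl⟩
    · exact Or.inl ⟨rfl, h1, by omega⟩
    · exact Or.inr (Or.inl h)
    · exact Or.inr (Or.inr h)

theorem balls_succ_one (a b c : ℕ) : balls a (b + 1) c = insert (1, b + 1) (balls a b c) := by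
  ext ⟨r, i⟩
  simp only [mem_balls, Finset.mem_insert, Prod.mk.injEq]
  constructor
  · rintro (h | ⟨rfl, h1, h2⟩ | h)
    · exact Or.inr (Or.inl h)
    · by_cases h3 : i = b + 1
      · exact Or.inl ⟨rfl, h3⟩
      · exact Or.inr (Or.inr (Or.inl ⟨rfl, h1, by omega⟩))
    · exact Or.inr (Or.inr (Or.inr h))
  · rintro (⟨rfl, rfl⟩ | h | ⟨rfl, h1, h2⟩ | h)
    · exact Or.inr (Or.inl ⟨rfl, by omega, le_rfl⟩)
    · exact Or.inl h
    · exact Or.inr (Or.inl ⟨rfl, h1, by omega⟩)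
    · exact Or.inr (Or.inr h)

theorem balls_succ_two (a b c : ℕ) : balls a b (c + 1) = insert (2, c) (balls a b c) := by
  ext ⟨r, i⟩
  simp only [mem_balls, Finset.mem_insert, Prod.mk.injEq]
  constructor
  · rintro (h | h | ⟨rfl, h1⟩)
    · exact Or.inr (Or.inl h)
    · exact Or.inr (Or.inr (Or.inl h))
    · by_cases h3 : i = c
      · exact Or.inl ⟨rfl, h3⟩
      · exact Or.inr (Or.inr (Or.inr ⟨rfl, by omega⟩))
  · rintro (⟨rfl, rfl⟩ | h | h | ⟨rfl, h1⟩)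
    · exact Or.inr (Or.inr ⟨rfl, by omega⟩)
    · exact Or.inl h
    · exact Or.inr (Or.inl h)
    · exact Or.inr (Or.inr ⟨rfl, by omega⟩)

theorem card_balls (a b c : ℕ) : (balls a b c).card = a + b + c := by
  induction c with
  | zero =>
    induction b with
    | zero =>
      induction a with
      | zero => rfl
      | succ a ih =>
        rw [balls_succ_zero, Finset.card_insert_of_notMem (by simp [mem_balls]), ih]
    | succ b ih =>
      rw [balls_succ_one, Finset.card_insert_of_notMem (by simp [mem_balls]), ih]
      omega
  | succ c ih =>
    rw [balls_succ_two, Finset.card_insert_of_notMem (by simp [mem_balls]), ih]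
    omega

theorem two_le_of_mem_balls {e : Fin 3 → E} (h : Frame e) {a b c : ℕ} :
    ∀ p ∈ balls a b c, ∀ q ∈ balls a b c, p ≠ q → 2 ≤ ‖pos e p - pos e q‖ := fun _ hp _ hq hpq =>
  two_le_norm_pos_sub h (isBall_of_mem hp) (isBall_of_mem hq) hpq

theorem pos_succ_sub (e : Fin 3 → E) (r : Fin 3) (i : ℕ) :
    pos e (r, i + 1) - pos e (r, i) = (2 : ℝ) • e r := by
  simp only [pos]
  push_cast
  module

theorem gap_pos_succ (e : Fin 3 → E) (v : Fin 3 × ℕ → E) (r : Fin 3) (i : ℕ) :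
    gap (pos e) v (r, i + 1) (r, i) = 2 * (⟪v (r, i + 1), e r⟫ - ⟪v (r, i), e r⟫) := by
  rw [gap, pos_succ_sub, real_inner_smul_left, inner_sub_right,
    real_inner_comm (v (r, i + 1)), real_inner_comm (v (r, i))]

/-- The velocity exchange of two neighbours in a row. -/
theorem bounce_pos (e : Fin 3 → E) (v : Fin 3 × ℕ → E) (r : Fin 3) (i : ℕ) :
    bounce (pos e) (r, i + 1) (r, i) v = hit (e r) (r, i + 1) (r, i) v := by
  rw [bounce, pos_succ_sub, smul_smul, inv_mul_cancel₀ two_ne_zero, one_smul]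

/-- A single moving ball in a row passes its velocity on along the row. -/
theorem chain {e : Fin 3 → E} (h : Frame e) {a b c k m n : ℕ} {r : Fin 3}
    (hmem : ∀ i, m ≤ i → i ≤ m + n → (r, i) ∈ balls a b c)
    (hn : ∀ p ∈ balls a b c, ∀ i, m < i → Nb p (r, i) → p.1 = r ∧ (p.2 + 1 = i ∨ i + 1 = p.2))
    (Q : ℕ → Set (Fin 3 × ℕ → E))
    (hQ : ∀ i v, m ≤ i → i < m + n → hit (e r) (r, i + 1) (r, i) v ∈ Q (i + 1) → v ∈ Q i)
    {y : Fin 3 × ℕ → E}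
    (hy : (y, Pi.single (r, m + n) (-e r)) ∈
      closure (Hist (pos e) (balls a b c) k ∩ {z | z.2 ∈ Q (m + n)}))
    (hr : Regular (pos e) (balls a b c) y (Pi.single (r, m + n) (-e r))) :
    ∃ y', (y', Pi.single (r, m) (-e r)) ∈
      closure (Hist (pos e) (balls a b c) (k + n) ∩ {z | z.2 ∈ Q m}) ∧
      Regular (pos e) (balls a b c) y' (Pi.single (r, m) (-e r)) := by
  induction n generalizing k y with
  | zero => exact ⟨y, hy, hr⟩
  | succ n ih =>
    set v : Fin 3 × ℕ → E := Pi.single (r, m + (n + 1)) (-e r) with hv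
    have ht : ∀ {p q}, p ∈ balls a b c → q ∈ balls a b c → (Touch (pos e) p q ↔ Nb p q) :=
      fun hp hq => touch_iff h (isBall_of_mem hp) (isBall_of_mem hq)
    have hi := hmem (m + n) (by omega) (by omega)
    have hj := hmem (m + (n + 1)) (by omega) le_rfl
    have vj : v (r, m + n + 1) = -e r := by rw [hv]; exact Pi.single_eq_same _ _
    have vne : ∀ {p}, p ≠ (r, m + (n + 1)) → v p = 0 := fun hp => Pi.single_eq_of_ne hp _
    have vi : v (r, m + n) = 0 := vne (by simp)
    have vk : v (r, m + n + 2) = 0 := vne (by simp; omega)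
    have g1 : gap (pos e) v (r, m + n + 1) (r, m + n) = -2 := by
      rw [gap_pos_succ, vj, vi, inner_neg_left, h.inner_self]; simp
    have g2 : gap (pos e) v (r, m + n + 2) (r, m + n + 1) = 2 := by
      rw [gap_pos_succ, vj, vk, inner_neg_left, h.inner_self]; simp
    have closing' : ∀ p ∈ balls a b c, Nb p (r, m + n + 1) →
        gap (pos e) v p (r, m + n + 1) < 0 → p = (r, m + n) := by
      intro p hp hnb hg
      obtain ⟨rfl, h2⟩ := hn p hp _ (by omega) hnb
      rcases h2 with h2 | h2
      · exact Prod.ext rfl (by simp only; omega)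
      · have e1 : p = (p.1, m + n + 2) := Prod.ext rfl (by simp only; omega)
        rw [e1, g2] at hg
        linarith
    have closing : ∀ p ∈ balls a b c, ∀ q ∈ balls a b c, Touch (pos e) p q →
        gap (pos e) v p q < 0 → (p = (r, m + n) ∧ q = (r, m + n + 1)) ∨
          (p = (r, m + n + 1) ∧ q = (r, m + n)) := by
      intro p hp q hq hpq hg
      by_cases h1 : q = (r, m + n + 1)
      · subst h1
        exact Or.inl ⟨closing' p hp ((ht hp hq).1 hpq) hg, rfl⟩
      by_cases h2 : p = (r, m + n + 1)
      · subst h2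
        exact Or.inr ⟨rfl, closing' q hq ((ht hq hp).1 hpq.symm) (by rwa [gap_swap])⟩
      · rw [hv, ← add_assoc, gap_single_of_ne _ _ h2 h1] at hg
        exact absurd hg (lt_irrefl _)
    have htouch : Touch (pos e) (r, m + n + 1) (r, m + n) :=
      (ht hj hi).2 (Or.inl ⟨rfl, Or.inr rfl⟩)
    obtain ⟨p, hp, q, hq, hpq, hg, y', hy', hr'⟩ := advance hy (two_le_of_mem_balls h) hr (by
      intro p hp q hq s hs hpq hps h1 h2
      rcases closing p hp q hq hpq h1 with ⟨h3, h4⟩ | ⟨h3, h4⟩ <;>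
      rcases closing p hp s hs hps h2 with ⟨h5, h6⟩ | ⟨h5, h6⟩
      · rw [h4, h6]
      · have := (Prod.mk.inj (h3.symm.trans h5)).2
        omega
      · have := (Prod.mk.inj (h3.symm.trans h5)).2
        omega
      · rw [h4, h6]) ⟨_, hj, _, hi, htouch, by rw [← add_assoc, g1]; norm_num⟩
    have hb : ∀ w, bounce (pos e) p q w = hit (e r) (r, m + n + 1) (r, m + n) w := by
      intro w
      rw [← bounce_pos]
      rcases closing p hp q hq hpq hg with ⟨rfl, rfl⟩ | ⟨rfl, rfl⟩
      · exact bounce_swap htouch.1 w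
      · rfl
    have hvv : bounce (pos e) p q v = Pi.single (r, m + n) (-e r) := by
      rw [hb]
      funext x
      by_cases h1 : x = (r, m + n + 1)
      · rw [h1, hit_left, vj, vi, Pi.single_eq_of_ne (by simp), sub_zero, inner_neg_left,
          h.inner_self]
        module
      by_cases h2 : x = (r, m + n)
      · rw [h2, hit_right _ (by simp), vj, vi, Pi.single_eq_same, sub_zero, inner_neg_left,
          h.inner_self]
        module
      · rw [hit_of_ne _ h1 h2, vne h1, Pi.single_eq_of_ne h2]
    rw [hvv] at hy' hr'
    have := ih (k := k + 1) (fun i h1 h2 => hmem i h1 (by omega))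
      (fun i v h1 h2 => hQ i v h1 (by omega)) (closure_mono ?_ hy') hr'
    · rwa [add_assoc, add_comm 1 n] at this
    · rintro z ⟨hz1, hz2⟩
      rw [mem_ofPred_eq, hb] at hz2
      exact ⟨hz1, hQ _ _ (by omega) (by omega) hz2⟩

end

section

variable {E : Type*} [NormedAddCommGroup E] [InnerProductSpace ℝ E]

theorem inner_pos_sub_pos {e : Fin 3 → E} {f : E} {r : Fin 3} {n : ℕ} {q : Fin 3 × ℕ}
    (hr : 0 < ⟪e r, f⟫) (hq : (q.1 = r ∧ q.2 < n) ∨ (1 ≤ q.2 ∧ ⟪e q.1, f⟫ < 0)) :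
    0 < ⟪pos e (r, n) - pos e q, f⟫ := by
  simp only [pos, inner_sub_left, real_inner_smul_left]
  rcases hq with ⟨h1, h2⟩ | ⟨h1, h2⟩
  · have : (q.2 : ℝ) < n := by exact_mod_cast h2
    rw [h1]
    nlinarith
  · have : (1 : ℝ) ≤ q.2 := by exact_mod_cast h1
    have : 0 ≤ 2 * (n : ℝ) * ⟪e r, f⟫ := by positivity
    nlinarith

/-- The collisions in the first row. -/
theorem nonempty_hist_zero {e : Fin 3 → E} (h : Frame e) (a : ℕ) :
    (Hist (pos e) (balls a 0 0) (∑ i ∈ Finset.range a, i)).Nonempty := by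
  induction a with
  | zero =>
    exact ⟨(0, 0), fun i hi => absurd hi (Finset.notMem_empty i), 0,
      Eventually.of_forall fun _ => Past.empty _ _⟩
  | succ a ih =>
    obtain ⟨⟨y, v⟩, hz⟩ := ih
    have hj : ((0, a + 1) : Fin 3 × ℕ) ∉ balls a 0 0 := by simp [mem_balls]
    obtain ⟨y', h1, h2⟩ := Hist.exists_insert hz hj (e := e 0) (d := 0)
      (fun i hi => two_le_norm_pos_sub h (Or.inr (by simp)) (isBall_of_mem hi)
        (fun hij => hj (hij ▸ hi)))
      (fun s _ q hq => by
        rw [smul_zero, add_zero]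
        refine inner_pos_sub_pos (by rw [h.inner_self]; exact one_pos) (Or.inl ?_)
        rcases mem_balls.1 hq with hq | hq | hq
        · exact ⟨hq.1, by omega⟩
        · omega
        · omega)
    rw [← balls_succ_zero] at h1 h2
    rw [add_comm a 1] at h1 h2
    obtain ⟨y'', h3, -⟩ := chain h (k := ∑ i ∈ Finset.range a, i) (m := 1) (n := a) (r := 0)
      (fun i h3 h4 => mem_balls.2 (Or.inl ⟨rfl, h3, h4⟩))
      (fun p _ i hi hnb => by
        rcases hnb with hnb | hnb | hnb
        · exact hnb
        · simp only at hnb; omega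
        · simp at hnb)
      (fun _ => univ) (fun _ _ _ _ _ => mem_univ _)
      (by
        refine closure_mono ?_ h1
        exact fun z hz => ⟨hz.1, mem_univ _⟩) (h2 _)
    obtain ⟨z, hz⟩ := closure_nonempty_iff.1 ⟨_, h3⟩
    rw [Finset.sum_range_succ, add_comm a 1]
    exact ⟨z, hz.1⟩

/-- The collisions in the first two rows. -/
theorem nonempty_hist_one {e : Fin 3 → E} (h : Frame e) (a b : ℕ) :
    (Hist (pos e) (balls a b 0)
      (∑ i ∈ Finset.range a, i + ∑ i ∈ Finset.range b, i)).Nonempty := by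
  induction b with
  | zero => exact nonempty_hist_zero h a
  | succ b ih =>
    obtain ⟨⟨y, v⟩, hz⟩ := ih
    have hj : ((1, b + 1) : Fin 3 × ℕ) ∉ balls a b 0 := by simp [mem_balls]
    obtain ⟨y', h1, h2⟩ := Hist.exists_insert hz hj (e := e 1) (d := 0)
      (fun i hi => two_le_norm_pos_sub h (Or.inr (by simp)) (isBall_of_mem hi)
        (fun hij => hj (hij ▸ hi)))
      (fun s _ q hq => by
        rw [smul_zero, add_zero]
        refine inner_pos_sub_pos (by rw [h.inner_self]; exact one_pos) ?_
        rcases mem_balls.1 hq with hq | hq | hq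
        · exact Or.inr ⟨hq.2.1, by rw [hq.1, h.inner_zero_one]; norm_num⟩
        · exact Or.inl ⟨hq.1, by omega⟩
        · omega)
    rw [← balls_succ_one, add_comm b 1] at h1 h2
    obtain ⟨y'', h3, -⟩ := chain h
      (k := ∑ i ∈ Finset.range a, i + ∑ i ∈ Finset.range b, i) (m := 1) (n := b) (r := 1)
      (fun i h3 h4 => mem_balls.2 (Or.inr (Or.inl ⟨rfl, h3, h4⟩)))
      (fun p _ i hi hnb => by
        rcases hnb with hnb | hnb | hnb
        · exact hnb
        · simp only at hnb; omega
        · simp at hnb)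
      (fun _ => univ) (fun _ _ _ _ _ => mem_univ _)
      (by
        refine closure_mono ?_ h1
        exact fun z hz => ⟨hz.1, mem_univ _⟩) (h2 _)
    obtain ⟨z, hz⟩ := closure_nonempty_iff.1 ⟨_, h3⟩
    rw [Finset.sum_range_succ, add_comm b 1, ← add_assoc]
    exact ⟨z, hz.1⟩

/-- The velocities `t i`, along a row, of the balls `1, …, a`, where precisely those in `P`
move, outwards with increasing velocities greater than `q`. -/
structure Row (a : ℕ) (t : ℕ → ℝ) (P : Finset ℕ) (q : ℝ) : Prop where
  sub : ∀ i ∈ P, 1 ≤ i ∧ i ≤ a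
  off : ∀ i, i ∉ P → t i = 0
  mono : ∀ i ∈ P, ∀ j ∈ P, i < j → t i < t j
  lt : ∀ i ∈ P, q < t i

theorem Row.nonneg {a : ℕ} {t : ℕ → ℝ} {P : Finset ℕ} {q : ℝ} (h : Row a t P q) (hq : 0 < q)
    (i : ℕ) : 0 ≤ t i := by
  by_cases hi : i ∈ P
  · exact (hq.trans (h.lt i hi)).le
  · exact (h.off i hi).ge

theorem Row.closing {a : ℕ} {t : ℕ → ℝ} {P : Finset ℕ} {q : ℝ} (h : Row a t P q) (hq : 0 < q)
    {i : ℕ} (hi : t (i + 1) < t i) : i ∈ P ∧ i + 1 ∉ P := by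
  have h1 : i ∈ P := by
    by_contra h1
    rw [h.off i h1] at hi
    exact absurd (h.nonneg hq (i + 1)) (not_le.2 hi)
  exact ⟨h1, fun h2 => lt_asymm hi (h.mono i h1 _ h2 i.lt_succ_self)⟩

theorem Row.move {a : ℕ} {t : ℕ → ℝ} {P : Finset ℕ} {q : ℝ} (h : Row a t P q) {i : ℕ}
    (hi : i ∈ P) (ha : i + 1 ≤ a) :
    Row a (Function.update (Function.update t i 0) (i + 1) (t i)) (insert (i + 1) (P.erase i)) q := by
  have val : ∀ j ∈ insert (i + 1) (P.erase i),
      (j = i + 1 ∧ Function.update (Function.update t i 0) (i + 1) (t i) j = t i) ∨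
      (j ∈ P ∧ j ≠ i ∧ j ≠ i + 1 ∧
        Function.update (Function.update t i 0) (i + 1) (t i) j = t j) := by
    intro j hj
    by_cases h1 : j = i + 1
    · exact Or.inl ⟨h1, by rw [h1, Function.update_self]⟩
    · obtain ⟨h2, h3⟩ := Finset.mem_erase.1 (Finset.mem_of_mem_insert_of_ne hj h1)
      exact Or.inr ⟨h3, h2, h1, by rw [Function.update_of_ne h1, Function.update_of_ne h2]⟩
  constructor
  · intro j hj
    rcases val j hj with ⟨h1, -⟩ | ⟨h1, -⟩
    · omega
    · exact h.sub j h1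
  · intro j hj
    rw [Finset.mem_insert, Finset.mem_erase, not_or] at hj
    rw [Function.update_of_ne hj.1]
    by_cases h1 : j = i
    · rw [h1, Function.update_self]
    · rw [Function.update_of_ne h1]
      exact h.off j fun h2 => hj.2 ⟨h1, h2⟩
  · intro j hj l hl hjl
    rcases val j hj with ⟨h1, h2⟩ | ⟨h1, h2, h3, h4⟩ <;>
    rcases val l hl with ⟨h5, h6⟩ | ⟨h5, h6, h7, h8⟩
    · omega
    · rw [h2, h8]
      exact h.mono i hi l h5 (by omega)
    · rw [h4, h6]
      exact h.mono j h1 i hi (by omega)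
    · rw [h4, h8]
      exact h.mono j h1 l h5 hjl
  · intro j hj
    rcases val j hj with ⟨-, h2⟩ | ⟨h1, -, -, h4⟩
    · rw [h2]; exact h.lt i hi
    · rw [h4]; exact h.lt j h1

theorem Row.push {a : ℕ} {t : ℕ → ℝ} {P : Finset ℕ} {q q' : ℝ} (h : Row a t P q) (hq : q' < q)
    (ha : 1 ≤ a) (h1 : 1 ∉ P) : Row a (Function.update t 1 q) (insert 1 P) q' := by
  have val : ∀ j ∈ P, j ≠ 1 ∧ Function.update t 1 q j = t j := fun j hj =>
    have : j ≠ 1 := fun h2 => h1 (h2 ▸ hj)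
    ⟨this, Function.update_of_ne this _ _⟩
  constructor
  · intro j hj
    rcases Finset.mem_insert.1 hj with rfl | hj
    · exact ⟨le_rfl, ha⟩
    · exact h.sub j hj
  · intro j hj
    rw [Finset.mem_insert, not_or] at hj
    rw [Function.update_of_ne hj.1]
    exact h.off j hj.2
  · intro j hj l hl hjl
    rcases Finset.mem_insert.1 hj with rfl | hj <;> rcases Finset.mem_insert.1 hl with rfl | hl
    · omega
    · rw [Function.update_self, (val l hl).2]
      exact h.lt l hl
    · have := h.sub j hj
      omega
    · rw [(val j hj).2, (val l hl).2]
      exact h.mono j hj l hl hjl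
  · intro j hj
    rcases Finset.mem_insert.1 hj with rfl | hj
    · rwa [Function.update_self]
    · rw [(val j hj).2]
      exact hq.trans (h.lt j hj)

theorem Row.subset {a : ℕ} {t : ℕ → ℝ} {P : Finset ℕ} {q : ℝ} (h : Row a t P q) :
    P ⊆ Finset.Icc 1 a := fun i hi => Finset.mem_Icc.2 (h.sub i hi)

theorem Row.eq_Icc {a : ℕ} {t : ℕ → ℝ} {P : Finset ℕ} {q : ℝ} (h : Row a t P q)
    (h1 : 1 ≤ a → 1 ∈ P) (h2 : ∀ i ∈ P, i + 1 ≤ a → i + 1 ∈ P) : P = Finset.Icc 1 a := by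
  refine h.subset.antisymm fun i hi => ?_
  obtain ⟨h3, hia⟩ := Finset.mem_Icc.1 hi
  clear hi
  induction i with
  | zero => omega
  | succ i ih =>
    rcases Nat.eq_zero_or_pos i with rfl | hi'
    · exact h1 hia
    · exact h2 i (ih hi' (by omega)) hia

theorem two_mul_sum_Icc (a : ℕ) : 2 * ∑ i ∈ Finset.Icc 1 a, i = a * (a + 1) := by
  induction a with
  | zero => rfl
  | succ a ih =>
    rw [Finset.sum_Icc_succ_top (by omega), mul_add, ih]
    ring

theorem Row.two_mul_sum_le {a : ℕ} {t : ℕ → ℝ} {P : Finset ℕ} {q : ℝ} (h : Row a t P q) :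
    2 * ∑ i ∈ P, i ≤ a * (a + 1) := by
  rw [← two_mul_sum_Icc]
  exact Nat.mul_le_mul_left 2 (Finset.sum_le_sum_of_subset h.subset)

/-- Velocities during the phase in which the central ball collides alternately with the first
two rows: it is heading for row `r`. -/
structure Phase (e : Fin 3 → E) (a : ℕ) (v : Fin 3 × ℕ → E) (r s : Fin 3) (q : ℝ)
    (t u : ℕ → ℝ) (P U : Finset ℕ) : Prop where
  rows : (r = 0 ∧ s = 1) ∨ (r = 1 ∧ s = 0)
  row_r : Row a t P q
  row_s : Row a u U (3 / 5 * q)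
  q_pos : 0 < q
  vel_r : ∀ i, 1 ≤ i → v (r, i) = t i • e r
  vel_s : ∀ i, 1 ≤ i → v (s, i) = u i • e s
  vel_two : ∀ i, 1 ≤ i → v (2, i) = 0
  center_r : ⟪v (2, 0), e r⟫ = q
  center_s : ⟪v (2, 0), e s⟫ = 0
  card_le : P.card ≤ U.card
  card_ge : U.card ≤ P.card + 1

namespace Phase

variable {e : Fin 3 → E} {a : ℕ} {v : Fin 3 × ℕ → E} {r s : Fin 3} {q : ℝ} {t u : ℕ → ℝ}
  {P U : Finset ℕ}

theorem ne (h : Phase e a v r s q t u P U) : r ≠ s ∧ r ≠ 2 ∧ s ≠ 2 := by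
  rcases h.rows with ⟨rfl, rfl⟩ | ⟨rfl, rfl⟩ <;> decide

theorem cases (h : Phase e a v r s q t u P U) (x : Fin 3) : x = r ∨ x = s ∨ x = 2 := by
  rcases h.rows with ⟨rfl, rfl⟩ | ⟨rfl, rfl⟩ <;> fin_cases x <;> decide

theorem inner_rows (h : Phase e a v r s q t u P U) (he : Frame e) : ⟪e r, e s⟫ = -(3 / 5) := by
  rcases h.rows with ⟨rfl, rfl⟩ | ⟨rfl, rfl⟩
  · exact he.inner_zero_one
  · rw [real_inner_comm]; exact he.inner_zero_one

theorem inner_center_two (h : Phase e a v r s q t u P U) (he : Frame e) :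
    ⟪v (2, 0), e 2⟫ < 0 := by
  have h1 := h.q_pos
  have h2 := h.center_r
  have h3 := h.center_s
  rw [he.eq_two, inner_sub_right, real_inner_smul_right, real_inner_smul_right]
  rcases h.rows with ⟨rfl, rfl⟩ | ⟨rfl, rfl⟩
  · rw [h2, h3]; linarith
  · rw [h2, h3]; linarith

end Phase

/-- Ball `x` is about to hit ball `y`. -/
def Closing (r s : Fin 3) (P U : Finset ℕ) (x y : Fin 3 × ℕ) : Prop :=
  (x.1 = r ∧ x.2 ∈ P ∧ y = (r, x.2 + 1) ∧ x.2 + 1 ∉ P) ∨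
  (x.1 = s ∧ x.2 ∈ U ∧ y = (s, x.2 + 1) ∧ x.2 + 1 ∉ U) ∨
  (x = (2, 0) ∧ y = (r, 1) ∧ 1 ∉ P)

theorem gap_pos_row (e : Fin 3 → E) (v : Fin 3 × ℕ → E) (r : Fin 3) (i j : ℕ) :
    gap (pos e) v (r, i) (r, j) = 2 * (i - j) * (⟪v (r, i), e r⟫ - ⟪v (r, j), e r⟫) := by
  simp only [gap, pos]
  rw [← sub_smul, real_inner_smul_left, inner_sub_right, real_inner_comm (v (r, i)),
    real_inner_comm (v (r, j))]
  ring

theorem gap_pos_center (e : Fin 3 → E) (v : Fin 3 × ℕ → E) (r : Fin 3) (i : ℕ) :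
    gap (pos e) v (2, 0) (r, i) = 2 * i * (⟪v (r, i), e r⟫ - ⟪v (2, 0), e r⟫) := by
  have : pos e (2, 0) = 0 := by simp [pos]
  rw [gap, this, zero_sub, inner_neg_left, pos, real_inner_smul_left, inner_sub_right,
    real_inner_comm (v (r, i)), real_inner_comm (v (2, 0))]
  ring

namespace Phase

variable {e : Fin 3 → E} {a : ℕ} {v : Fin 3 × ℕ → E} {r s : Fin 3} {q : ℝ} {t u : ℕ → ℝ}
  {P U : Finset ℕ}

theorem gap_row_r (h : Phase e a v r s q t u P U) (he : Frame e) {i j : ℕ} (hi : 1 ≤ i)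
    (hj : 1 ≤ j) : gap (pos e) v (r, i) (r, j) = 2 * (i - j) * (t i - t j) := by
  rw [gap_pos_row, h.vel_r i hi, h.vel_r j hj]
  simp only [real_inner_smul_left, he.inner_self, mul_one]

theorem gap_row_s (h : Phase e a v r s q t u P U) (he : Frame e) {i j : ℕ} (hi : 1 ≤ i)
    (hj : 1 ≤ j) : gap (pos e) v (s, i) (s, j) = 2 * (i - j) * (u i - u j) := by
  rw [gap_pos_row, h.vel_s i hi, h.vel_s j hj]
  simp only [real_inner_smul_left, he.inner_self, mul_one]

theorem gap_center_r (h : Phase e a v r s q t u P U) (he : Frame e) {i : ℕ} (hi : 1 ≤ i) :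
    gap (pos e) v (2, 0) (r, i) = 2 * i * (t i - q) := by
  rw [gap_pos_center, h.center_r, h.vel_r i hi, real_inner_smul_left, he.inner_self, mul_one]

theorem gap_center_s (h : Phase e a v r s q t u P U) (he : Frame e) {i : ℕ} (hi : 1 ≤ i) :
    gap (pos e) v (2, 0) (s, i) = 2 * i * u i := by
  rw [gap_pos_center, h.center_s, h.vel_s i hi, real_inner_smul_left, he.inner_self, mul_one,
    sub_zero]

theorem gap_center_two (h : Phase e a v r s q t u P U) {i : ℕ} (hi : 1 ≤ i) :
    gap (pos e) v (2, 0) (2, i) = 2 * i * -⟪v (2, 0), e 2⟫ := by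
  rw [gap_pos_center, h.vel_two i hi, inner_zero_left, zero_sub]

theorem closing_of_center (h : Phase e a v r s q t u P U) (he : Frame e) {x : Fin 3}
    (hg : gap (pos e) v (2, 0) (x, 1) < 0) : Closing r s P U (2, 0) (x, 1) := by
  rcases h.cases x with rfl | rfl | rfl
  · rw [h.gap_center_r he le_rfl] at hg
    refine Or.inr (Or.inr ⟨rfl, rfl, fun h1 => ?_⟩)
    have := h.row_r.lt 1 h1
    push_cast at hg
    linarith
  · rw [h.gap_center_s he le_rfl] at hg
    have := h.row_s.nonneg (by linarith [h.q_pos]) 1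
    push_cast at hg
    linarith
  · rw [h.gap_center_two le_rfl] at hg
    have := h.inner_center_two he
    push_cast at hg
    linarith

theorem closing_of_row (h : Phase e a v r s q t u P U) (he : Frame e) {x : Fin 3} {i : ℕ}
    (hi : IsBall (x, i)) (hg : gap (pos e) v (x, i + 1) (x, i) < 0) :
    Closing r s P U (x, i) (x, i + 1) := by
  rcases Nat.eq_zero_or_pos i with rfl | hi'
  · have hx : x = 2 := by simpa [IsBall] using hi
    subst hx
    rw [gap_swap] at hg
    exact h.closing_of_center he hg
  rcases h.cases x with rfl | rfl | rfl
  · rw [h.gap_row_r he (by omega) hi'] at hg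
    push_cast at hg
    obtain ⟨h1, h2⟩ := h.row_r.closing h.q_pos (i := i) (by linarith)
    exact Or.inl ⟨rfl, h1, rfl, h2⟩
  · rw [h.gap_row_s he (by omega) hi'] at hg
    push_cast at hg
    obtain ⟨h1, h2⟩ := h.row_s.closing (by linarith [h.q_pos]) (i := i) (by linarith)
    exact Or.inr (Or.inl ⟨rfl, h1, rfl, h2⟩)
  · rw [gap_pos_row, h.vel_two i hi', h.vel_two (i + 1) (by omega)] at hg
    simp at hg

theorem closing (h : Phase e a v r s q t u P U) (he : Frame e) {x y : Fin 3 × ℕ} (hx : IsBall x)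
    (hy : IsBall y) (hxy : Touch (pos e) x y) (hg : gap (pos e) v x y < 0) :
    Closing r s P U x y ∨ Closing r s P U y x := by
  obtain ⟨x, i⟩ := x
  obtain ⟨y, j⟩ := y
  rcases (touch_iff he hx hy).1 hxy with ⟨h1, h2⟩ | ⟨h1, h2⟩ | ⟨h1, h2⟩
  · simp only at h1 h2
    subst h1
    rcases h2 with rfl | rfl
    · exact Or.inl (h.closing_of_row he hx (by rwa [gap_swap]))
    · exact Or.inr (h.closing_of_row he hy hg)
  · simp only at h2
    subst h2
    rw [h1] at hg ⊢
    exact Or.inl (h.closing_of_center he hg)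
  · simp only at h2
    subst h2
    rw [h1] at hg ⊢
    exact Or.inr (h.closing_of_center he (by rwa [gap_swap]))

/-- The pairs that are about to collide are disjoint. -/
theorem closing_unique (h : Phase e a v r s q t u P U) {x y z : Fin 3 × ℕ}
    (h1 : Closing r s P U x y ∨ Closing r s P U y x)
    (h2 : Closing r s P U x z ∨ Closing r s P U z x) : y = z := by
  obtain ⟨n1, n2, n3⟩ := h.ne
  have p0 : 0 ∉ P := fun h3 => by have := h.row_r.sub 0 h3; omega
  have u0 : 0 ∉ U := fun h3 => by have := h.row_s.sub 0 h3; omega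
  obtain ⟨x, i⟩ := x
  obtain ⟨y, j⟩ := y
  obtain ⟨z, l⟩ := z
  simp only [Closing, Prod.mk.injEq] at h1 h2 ⊢
  grind

theorem bounce_eq (e : Fin 3 → E) {P U : Finset ℕ} {r s : Fin 3} {x y : Fin 3 × ℕ}
    (hxy : Closing r s P U x y) (w : Fin 3 × ℕ → E) :
    bounce (pos e) y x w = hit (e y.1) y x w := by
  obtain ⟨x, i⟩ := x
  rcases hxy with ⟨rfl, -, rfl, -⟩ | ⟨rfl, -, rfl, -⟩ | ⟨hx, rfl, -⟩
  · exact bounce_pos e w _ i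
  · exact bounce_pos e w _ i
  · rw [hx, bounce]
    congr 1
    simp [pos]

theorem hit_hit_row {e : Fin 3 → E} (he : Frame e) {v : Fin 3 × ℕ → E} {x : Fin 3} {i : ℕ} {c : ℝ}
    (h1 : v (x, i) = c • e x) (h2 : v (x, i + 1) = 0) :
    hit (e x) (x, i + 1) (x, i) v = Function.update (Function.update v (x, i) 0) (x, i + 1)
      (c • e x) := by
  funext y
  by_cases h3 : y = (x, i + 1)
  · rw [h3, hit_left, Function.update_self, h1, h2, inner_sub_left,
      inner_zero_left, real_inner_smul_left, he.inner_self]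
    module
  by_cases h4 : y = (x, i)
  · rw [h4, hit_right _ (by simp), Function.update_of_ne (by simp), Function.update_self, h1, h2,
      inner_sub_left, inner_zero_left, real_inner_smul_left, he.inner_self]
    module
  · rw [hit_of_ne _ h3 h4, Function.update_of_ne h3, Function.update_of_ne h4]

end Phase

end

section

variable {E : Type*} [NormedAddCommGroup E] [InnerProductSpace ℝ E]

theorem sum_insert_erase {P : Finset ℕ} {i : ℕ} (hi : i ∈ P) (h : i + 1 ∉ P) :
    ∑ j ∈ insert (i + 1) (P.erase i), j = ∑ j ∈ P, j + 1 := by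
  have h1 : i + 1 ∉ P.erase i := fun h1 => h (Finset.mem_of_mem_erase h1)
  rw [Finset.sum_insert h1, ← Finset.add_sum_erase P (fun j => j) hi]
  omega

theorem card_insert_erase {P : Finset ℕ} {i : ℕ} (hi : i ∈ P) (h : i + 1 ∉ P) :
    (insert (i + 1) (P.erase i)).card = P.card := by
  have h1 : i + 1 ∉ P.erase i := fun h1 => h (Finset.mem_of_mem_erase h1)
  rw [Finset.card_insert_of_notMem h1, Finset.card_erase_add_one hi]

theorem update_update_row {e : Fin 3 → E} {v : Fin 3 × ℕ → E} {x : Fin 3} {t : ℕ → ℝ} {i : ℕ}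
    (hv : ∀ j, 1 ≤ j → v (x, j) = t j • e x) (j : ℕ) (hj : 1 ≤ j) :
    Function.update (Function.update v (x, i) 0) (x, i + 1) (t i • e x) (x, j) =
      Function.update (Function.update t i 0) (i + 1) (t i) j • e x := by
  by_cases h1 : j = i + 1
  · subst h1; simp
  by_cases h2 : j = i
  · subst h2; simp
  · rw [Function.update_of_ne h1, Function.update_of_ne h2, Function.update_of_ne (by simpa using h1),
      Function.update_of_ne (by simpa using h2), hv j hj]

theorem update_update_of_ne {F : Type*} [Zero F] {v : Fin 3 × ℕ → F} {x : Fin 3} {i : ℕ} {w : F}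
    {y : Fin 3 × ℕ}
    (h : y.1 ≠ x) : Function.update (Function.update v (x, i) 0) (x, i + 1) w y = v y := by
  have h1 : ∀ j, y ≠ (x, j) := fun j hj => h (by rw [hj])
  rw [Function.update_of_ne (h1 _), Function.update_of_ne (h1 _)]

namespace Phase

variable {e : Fin 3 → E} {a : ℕ} {v : Fin 3 × ℕ → E} {r s : Fin 3} {q : ℝ} {t u : ℕ → ℝ}
  {P U : Finset ℕ}

theorem move_r (h : Phase e a v r s q t u P U) {i : ℕ} (hi : i ∈ P) (hi' : i + 1 ∉ P)
    (ha : i + 1 ≤ a) :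
    Phase e a (Function.update (Function.update v (r, i) 0) (r, i + 1) (t i • e r)) r s q
      (Function.update (Function.update t i 0) (i + 1) (t i)) u (insert (i + 1) (P.erase i)) U := by
  obtain ⟨h1, h2, -⟩ := h.ne
  have hc := card_insert_erase hi hi'
  constructor
  · exact h.rows
  · exact h.row_r.move hi ha
  · exact h.row_s
  · exact h.q_pos
  · exact update_update_row h.vel_r
  · intro j hj
    rw [update_update_of_ne h1.symm]
    exact h.vel_s j hj
  · intro j hj
    rw [update_update_of_ne h2.symm]
    exact h.vel_two j hj
  · rw [update_update_of_ne h2.symm]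
    exact h.center_r
  · rw [update_update_of_ne h2.symm]
    exact h.center_s
  · rw [hc]; exact h.card_le
  · rw [hc]; exact h.card_ge

theorem move_s (h : Phase e a v r s q t u P U) {i : ℕ} (hi : i ∈ U) (hi' : i + 1 ∉ U)
    (ha : i + 1 ≤ a) :
    Phase e a (Function.update (Function.update v (s, i) 0) (s, i + 1) (u i • e s)) r s q
      t (Function.update (Function.update u i 0) (i + 1) (u i)) P (insert (i + 1) (U.erase i)) := by
  obtain ⟨h1, -, h2⟩ := h.ne
  have hc := card_insert_erase hi hi'
  constructor
  · exact h.rows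
  · exact h.row_r
  · exact h.row_s.move hi ha
  · exact h.q_pos
  · intro j hj
    rw [update_update_of_ne h1]
    exact h.vel_r j hj
  · exact update_update_row h.vel_s
  · intro j hj
    rw [update_update_of_ne h2.symm]
    exact h.vel_two j hj
  · rw [update_update_of_ne h2.symm]
    exact h.center_r
  · rw [update_update_of_ne h2.symm]
    exact h.center_s
  · rw [hc]; exact h.card_le
  · rw [hc]; exact h.card_ge

/-- The central ball hits row `r` and turns to row `s`. -/
theorem push (h : Phase e a v r s q t u P U) (he : Frame e) (h1 : 1 ∉ P) (ha : 1 ≤ a) :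
    Phase e a (hit (e r) (r, 1) (2, 0) v) s r (3 / 5 * q) u (Function.update t 1 q) U
      (insert 1 P) := by
  obtain ⟨n1, n2, n3⟩ := h.ne
  have hq := h.q_pos
  have hw : ⟪v (r, 1) - v (2, 0), e r⟫ = -q := by
    rw [inner_sub_left, h.center_r, h.vel_r 1 le_rfl, h.row_r.off 1 h1]
    simp
  have w1 : hit (e r) (r, 1) (2, 0) v (r, 1) = q • e r := by
    rw [hit_left, hw, h.vel_r 1 le_rfl, h.row_r.off 1 h1]
    module
  have w0 : hit (e r) (r, 1) (2, 0) v (2, 0) = v (2, 0) - q • e r := by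
    rw [hit_right _ (by simp), hw]
    module
  have w : ∀ x i, 1 ≤ i → (x, i) ≠ (r, 1) → hit (e r) (r, 1) (2, 0) v (x, i) = v (x, i) := by
    intro x i hi hne
    refine hit_of_ne _ hne ?_ _
    intro h3
    have := (Prod.mk.inj h3).2
    omega
  constructor
  · rcases h.rows with ⟨rfl, rfl⟩ | ⟨rfl, rfl⟩
    · exact Or.inr ⟨rfl, rfl⟩
    · exact Or.inl ⟨rfl, rfl⟩
  · exact h.row_s
  · exact h.row_r.push (by linarith) ha h1
  · positivity
  · intro i hi
    rw [w s i hi (fun h3 => n1.symm (Prod.mk.inj h3).1)]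
    exact h.vel_s i hi
  · intro i hi
    by_cases h3 : i = 1
    · rw [h3, w1, Function.update_self]
    · rw [w r i hi (fun h4 => h3 (Prod.mk.inj h4).2), Function.update_of_ne h3]
      exact h.vel_r i hi
  · intro i hi
    rw [w 2 i hi (fun h3 => n2.symm (Prod.mk.inj h3).1)]
    exact h.vel_two i hi
  · rw [w0, inner_sub_left, real_inner_smul_left, h.center_s, h.inner_rows he]
    ring
  · rw [w0, inner_sub_left, real_inner_smul_left, h.center_r, he.inner_self]
    ring
  · rw [Finset.card_insert_of_notMem h1]; exact h.card_ge
  · rw [Finset.card_insert_of_notMem h1]; have := h.card_le; omega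

/-- A collision leads to another state of the same phase. -/
theorem exists_hit (h : Phase e a v r s q t u P U) (he : Frame e) {x y : Fin 3 × ℕ}
    (hxy : Closing r s P U x y) (hy : y.2 ≤ a) :
    ∃ r' s' q' t' u' P' U', Phase e a (hit (e y.1) y x v) r' s' q' t' u' P' U' ∧
      ∑ i ∈ P', i + ∑ i ∈ U', i = ∑ i ∈ P, i + ∑ i ∈ U, i + 1 := by
  obtain ⟨x, i⟩ := x
  rcases hxy with ⟨h1, h2, rfl, h3⟩ | ⟨h1, h2, rfl, h3⟩ | ⟨h1, rfl, h2⟩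
  · simp only at h1 h2 h3 hy ⊢
    subst h1
    rw [hit_hit_row he (h.vel_r i (h.row_r.sub i h2).1)
      (by rw [h.vel_r _ (by omega), h.row_r.off _ h3, zero_smul])]
    refine ⟨_, _, _, _, _, _, _, h.move_r h2 h3 hy, ?_⟩
    rw [sum_insert_erase h2 h3]
    omega
  · simp only at h1 h2 h3 hy ⊢
    subst h1
    rw [hit_hit_row he (h.vel_s i (h.row_s.sub i h2).1)
      (by rw [h.vel_s _ (by omega), h.row_s.off _ h3, zero_smul])]
    refine ⟨_, _, _, _, _, _, _, h.move_s h2 h3 hy, ?_⟩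
    rw [sum_insert_erase h2 h3]
    omega
  · rw [h1]
    refine ⟨_, _, _, _, _, _, _, h.push he h2 hy, ?_⟩
    rw [Finset.sum_insert h2]
    omega

theorem exists_closing (h : Phase e a v r s q t u P U)
    (hf : ¬ (P = Finset.Icc 1 a ∧ U = Finset.Icc 1 a)) :
    ∃ x y, Closing r s P U x y ∧ IsBall x ∧ y.1 ≠ 2 ∧ 1 ≤ y.2 ∧ x.2 ≤ a ∧ y.2 ≤ a ∧
      (x.1 = 2 → x = (2, 0)) := by
  obtain ⟨-, n2, n3⟩ := h.ne
  by_contra! hc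
  have hP : P = Finset.Icc 1 a := by
    refine h.row_r.eq_Icc (fun ha => ?_) (fun i hi ha => ?_)
    · by_contra h1
      exact (hc (2, 0) (r, 1) (Or.inr (Or.inr ⟨rfl, rfl, h1⟩)) (Or.inl rfl) n2 le_rfl a.zero_le ha).2
        rfl
    · by_contra h1
      exact n2 (hc (r, i) (r, i + 1) (Or.inl ⟨rfl, hi, rfl, h1⟩) (Or.inr (h.row_r.sub i hi).1) n2
        (by simp) (h.row_r.sub i hi).2 ha).1
  refine hf ⟨hP, Finset.eq_of_subset_of_card_le h.row_s.subset ?_⟩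
  rw [← hP]
  exact h.card_le

end Phase

/-- Velocities for which the balls `l, …, m - 1` of the last row separate. -/
def Sorted (e : Fin 3 → E) (l m : ℕ) : Set (Fin 3 × ℕ → E) :=
  {v | ∀ i j, l ≤ i → i < j → j < m → ⟪v (2, i), e 2⟫ < ⟪v (2, j), e 2⟫}

theorem Phase.gap_neg {e : Fin 3 → E} {a : ℕ} {v : Fin 3 × ℕ → E} {r s : Fin 3} {q : ℝ}
    {t u : ℕ → ℝ} {P U : Finset ℕ} (h : Phase e a v r s q t u P U) (he : Frame e)
    {x y : Fin 3 × ℕ} (hxy : Closing r s P U x y) : Nb x y ∧ gap (pos e) v x y < 0 := by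
  have hq := h.q_pos
  obtain ⟨x, i⟩ := x
  rcases hxy with ⟨h1, h2, rfl, h3⟩ | ⟨h1, h2, rfl, h3⟩ | ⟨h1, rfl, h2⟩
  · simp only at h1 h2 h3 ⊢
    subst h1
    refine ⟨Or.inl ⟨rfl, Or.inl rfl⟩, ?_⟩
    rw [h.gap_row_r he (h.row_r.sub i h2).1 (by omega), h.row_r.off _ h3]
    have := h.row_r.lt i h2
    push_cast
    linarith
  · simp only at h1 h2 h3 ⊢
    subst h1
    refine ⟨Or.inl ⟨rfl, Or.inl rfl⟩, ?_⟩
    rw [h.gap_row_s he (h.row_s.sub i h2).1 (by omega), h.row_s.off _ h3]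
    have := h.row_s.lt i h2
    push_cast
    linarith
  · rw [h1]
    refine ⟨Or.inr (Or.inl ⟨rfl, rfl⟩), ?_⟩
    rw [h.gap_center_r he le_rfl, h.row_r.off 1 h2]
    push_cast
    linarith

/-- All the collisions of the phase take place. -/
theorem Phase.run {e : Fin 3 → E} {a : ℕ} {v : Fin 3 × ℕ → E} {r s : Fin 3} {q : ℝ}
    {t u : ℕ → ℝ} {P U : Finset ℕ} (h : Phase e a v r s q t u P U) (he : Frame e) {m k n : ℕ}
    (hn : n + (∑ i ∈ P, i + ∑ i ∈ U, i) = a * (a + 1)) {y : Fin 3 × ℕ → E}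
    (hy : (y, v) ∈ closure (Hist (pos e) (balls a a (m + 1)) k ∩ {z | z.2 ∈ Sorted e 1 (m + 1)}))
    (hr : Regular (pos e) (balls a a (m + 1)) y v) :
    ∃ y' v' r' s' q' t' u', (y', v') ∈
        closure (Hist (pos e) (balls a a (m + 1)) (k + n) ∩ {z | z.2 ∈ Sorted e 1 (m + 1)}) ∧
      Phase e a v' r' s' q' t' u' (Finset.Icc 1 a) (Finset.Icc 1 a) := by
  induction n generalizing k v r s q t u P U y with
  | zero =>
    by_cases hf : P = Finset.Icc 1 a ∧ U = Finset.Icc 1 a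
    · obtain ⟨rfl, rfl⟩ := hf
      exact ⟨_, _, _, _, _, _, _, hy, h⟩
    · exfalso
      obtain ⟨x, z, h1, -, -, -, -, h2, -⟩ := h.exists_closing hf
      obtain ⟨_, _, _, _, _, _, _, h3, h4⟩ := h.exists_hit he h1 h2
      have := h3.row_r.two_mul_sum_le
      have := h3.row_s.two_mul_sum_le
      omega
  | succ n ih =>
    have hf : ¬ (P = Finset.Icc 1 a ∧ U = Finset.Icc 1 a) := by
      rintro ⟨rfl, rfl⟩
      have := two_mul_sum_Icc a
      omega
    have row : ∀ x : Fin 3, x ≠ 2 → x = 0 ∨ x = 1 := by decide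
    have mem : ∀ {x : Fin 3 × ℕ}, x.1 ≠ 2 → 1 ≤ x.2 → x.2 ≤ a → x ∈ balls a a (m + 1) := by
      intro x h1 h2 h3
      rcases row x.1 h1 with h4 | h4
      · exact mem_balls.2 (Or.inl ⟨h4, h2, h3⟩)
      · exact mem_balls.2 (Or.inr (Or.inl ⟨h4, h2, h3⟩))
    have clos : ∀ x ∈ balls a a (m + 1), ∀ y ∈ balls a a (m + 1), Touch (pos e) x y →
        gap (pos e) v x y < 0 → Closing r s P U x y ∨ Closing r s P U y x :=
      fun x hx y hy hxy hg => h.closing he (isBall_of_mem hx) (isBall_of_mem hy) hxy hg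
    obtain ⟨x, hx, z, hz, hxz, hg, y', hy', hr'⟩ := advance hy (two_le_of_mem_balls he) hr
      (fun x hx y hy z hz hxy hxz h1 h2 =>
        h.closing_unique (clos x hx y hy hxy h1) (clos x hx z hz hxz h2)) (by
        obtain ⟨x, z, h1, h2, h3, h4, h5, h6, h7⟩ := h.exists_closing hf
        obtain ⟨h8, h9⟩ := h.gap_neg he h1
        have hx : x ∈ balls a a (m + 1) := by
          by_cases h10 : x.1 = 2
          · rw [h7 h10]
            exact mem_balls.2 (Or.inr (Or.inr ⟨rfl, m.succ_pos⟩))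
          · rcases h2 with h2 | h2
            · exact absurd h2 h10
            · exact mem h10 h2 h5
        have hz := mem h3 h4 h6
        exact ⟨x, hx, z, hz, (touch_iff he (isBall_of_mem hx) (isBall_of_mem hz)).2 h8, h9⟩)
    obtain ⟨x', z', hz', hcl, hb⟩ : ∃ x' z', z' ∈ balls a a (m + 1) ∧ Closing r s P U x' z' ∧
        ∀ w, bounce (pos e) x z w = hit (e z'.1) z' x' w := by
      rcases clos x hx z hz hxz hg with h1 | h1
      · exact ⟨x, z, hz, h1, fun w => by
          rw [bounce_swap hxz.1.symm, Phase.bounce_eq e h1]⟩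
      · exact ⟨z, x, hx, h1, fun w => Phase.bounce_eq e h1 w⟩
    have hza : z'.1 ≠ 2 ∧ z'.2 ≤ a := by
      obtain ⟨-, n2, n3⟩ := h.ne
      have h1 : z'.1 ≠ 2 := by
        rcases hcl with ⟨-, -, h1, -⟩ | ⟨-, -, h1, -⟩ | ⟨-, h1, -⟩ <;> rw [h1] <;> assumption
      rcases mem_balls.1 hz' with h2 | h2 | h2
      · exact ⟨h1, h2.2.2⟩
      · exact ⟨h1, h2.2.2⟩
      · exact absurd h2.1 h1
    have hx2 : ∀ i, 1 ≤ i → (2, i) ≠ x' := by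
      obtain ⟨-, n2, n3⟩ := h.ne
      rintro i hi rfl
      rcases hcl with ⟨h1, -, -, -⟩ | ⟨h1, -, -, -⟩ | ⟨h1, -, -⟩
      · exact n2 h1.symm
      · exact n3 h1.symm
      · have := (Prod.mk.inj h1).2
        omega
    obtain ⟨_, _, _, _, _, _, _, h3, h4⟩ := h.exists_hit he hcl hza.2
    rw [hb] at hy' hr'
    have := ih (k := k + 1) h3 (by omega) (closure_mono ?_ hy') hr'
    · rwa [add_assoc, add_comm 1 n] at this
    · rintro ⟨y, w⟩ ⟨h5, h6⟩
      refine ⟨h5, fun i j hi hij hj => ?_⟩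
      have h7 := h6 i j hi hij hj
      have h8 : ∀ i, (2, i) ≠ z' := fun i h8 => hza.1 (by rw [← h8])
      simp only [hb] at h7
      rwa [hit_of_ne _ (h8 i) (hx2 i hi), hit_of_ne _ (h8 j) (hx2 j (by omega))] at h7

/-- Two balls of different rows moving outwards separate. -/
theorem gap_pos_of_ne {e : Fin 3 → E} (he : Frame e) {v : Fin 3 × ℕ → E} {x y : Fin 3}
    (hxy : x ≠ y) {i j : ℕ} (hi : 1 ≤ i) (hj : 1 ≤ j) {α β : ℝ} (hα : v (x, i) = α • e x)
    (hβ : v (y, j) = β • e y) (h1 : 0 ≤ α) (h2 : 0 < β) : 0 < gap (pos e) v (x, i) (y, j) := by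
  have h3 : (1 : ℝ) ≤ i := by exact_mod_cast hi
  have h4 : (1 : ℝ) ≤ j := by exact_mod_cast hj
  have h5 : 0 ≤ (2 * i * β + 2 * j * α) * -⟪e x, e y⟫ :=
    mul_nonneg (by positivity) (neg_nonneg.2 (he.inner_nonpos hxy))
  have h6 : 0 < 2 * j * β := by positivity
  have h7 : 0 ≤ 2 * i * α := by positivity
  have : gap (pos e) v (x, i) (y, j) =
      2 * i * α + 2 * j * β + (2 * i * β + 2 * j * α) * -⟪e x, e y⟫ := by
    simp only [gap, pos, hα, hβ, inner_sub_left, inner_sub_right, real_inner_smul_left,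
      real_inner_smul_right, he.inner_self, real_inner_comm (e x) (e y)]
    ring
  linarith

theorem Row.gap_pos {a : ℕ} {t : ℕ → ℝ} {q : ℝ} (h : Row a t (Finset.Icc 1 a) q) {i j : ℕ}
    (hi : i ∈ Finset.Icc 1 a) (hj : j ∈ Finset.Icc 1 a) (hij : i ≠ j) :
    0 < 2 * ((i : ℝ) - j) * (t i - t j) := by
  rcases hij.lt_or_gt with h1 | h1
  · have h2 := h.mono i hi j hj h1
    have h3 : (i : ℝ) < j := by exact_mod_cast h1
    nlinarith
  · have h2 := h.mono j hj i hi h1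
    have h3 : (j : ℝ) < i := by exact_mod_cast h1
    nlinarith

/-- At the end of the phase all the pairs of balls separate, except for those in the last row. -/
theorem Phase.gap_pos {e : Fin 3 → E} {a : ℕ} {v : Fin 3 × ℕ → E} {r s : Fin 3} {q : ℝ}
    {t u : ℕ → ℝ} (h : Phase e a v r s q t u (Finset.Icc 1 a) (Finset.Icc 1 a)) (he : Frame e)
    {m : ℕ} {x y : Fin 3 × ℕ} (hx : x ∈ balls a a m) (hy : y ∈ balls a a m) (hxy : x ≠ y)
    (h2 : x.1 ≠ 2 ∨ y.1 ≠ 2 ∨ x.2 = 0 ∨ y.2 = 0) : 0 < gap (pos e) v x y := by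
  obtain ⟨n1, n2, n3⟩ := h.ne
  have hq := h.q_pos
  have tp : ∀ i ∈ Finset.Icc 1 a, 0 < t i := fun i hi => hq.trans (h.row_r.lt i hi)
  have up : ∀ i ∈ Finset.Icc 1 a, 0 < u i := fun i hi => by have := h.row_s.lt i hi; linarith
  have v2 : ∀ i, 1 ≤ i → v (2, i) = (0 : ℝ) • e 2 := fun i hi => by rw [h.vel_two i hi, zero_smul]
  have cr : ∀ i ∈ Finset.Icc 1 a, 0 < gap (pos e) v (2, 0) (r, i) := fun i hi => by
    have hi' := (Finset.mem_Icc.1 hi).1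
    have h3 := h.row_r.lt i hi
    have h4 : (1 : ℝ) ≤ i := by exact_mod_cast hi'
    rw [h.gap_center_r he hi']
    nlinarith
  have cs : ∀ i ∈ Finset.Icc 1 a, 0 < gap (pos e) v (2, 0) (s, i) := fun i hi => by
    have hi' := (Finset.mem_Icc.1 hi).1
    have h3 := up i hi
    have h4 : (1 : ℝ) ≤ i := by exact_mod_cast hi'
    rw [h.gap_center_s he hi']
    positivity
  have c2 : ∀ i, 1 ≤ i → 0 < gap (pos e) v (2, 0) (2, i) := fun i hi => by
    have h3 := h.inner_center_two he
    have h4 : (1 : ℝ) ≤ i := by exact_mod_cast hi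
    rw [h.gap_center_two hi]
    nlinarith
  have cases : ∀ x ∈ balls a a m, (x.1 = r ∧ x.2 ∈ Finset.Icc 1 a) ∨
      (x.1 = s ∧ x.2 ∈ Finset.Icc 1 a) ∨ x = (2, 0) ∨ (x.1 = 2 ∧ 1 ≤ x.2) := by
    rintro ⟨x, i⟩ hx
    have h3 := mem_balls.1 hx
    rcases h.cases x with rfl | rfl | rfl
    · refine Or.inl ⟨rfl, Finset.mem_Icc.2 ?_⟩
      rcases h3 with h3 | h3 | h3
      · exact h3.2
      · exact h3.2
      · exact absurd h3.1 n2
    · refine Or.inr (Or.inl ⟨rfl, Finset.mem_Icc.2 ?_⟩)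
      rcases h3 with h3 | h3 | h3
      · exact h3.2
      · exact h3.2
      · exact absurd h3.1 n3
    · rcases Nat.eq_zero_or_pos i with rfl | hi
      · exact Or.inr (Or.inr (Or.inl rfl))
      · exact Or.inr (Or.inr (Or.inr ⟨rfl, hi⟩))
  have hx' := cases x hx
  have hy' := cases y hy
  obtain ⟨x, i⟩ := x
  obtain ⟨y, j⟩ := y
  have one : ∀ {i}, i ∈ Finset.Icc 1 a → 1 ≤ i := fun hi => (Finset.mem_Icc.1 hi).1
  simp only [Prod.mk.injEq] at hx' hy' h2
  rcases hx' with ⟨rfl, hi⟩ | ⟨rfl, hi⟩ | ⟨rfl, rfl⟩ | ⟨rfl, hi⟩ <;>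
  rcases hy' with ⟨rfl, hj⟩ | ⟨rfl, hj⟩ | ⟨rfl, rfl⟩ | ⟨rfl, hj⟩
  · rw [h.gap_row_r he (one hi) (one hj)]
    exact h.row_r.gap_pos hi hj fun h3 => hxy (by rw [h3])
  · exact gap_pos_of_ne he n1 (one hi) (one hj) (h.vel_r i (one hi)) (h.vel_s j (one hj))
      (tp i hi).le (up j hj)
  · rw [gap_swap]; exact cr i hi
  · rw [gap_swap]
    exact gap_pos_of_ne he n2.symm hj (one hi) (v2 j hj) (h.vel_r i (one hi)) le_rfl (tp i hi)
  · rw [gap_swap]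
    exact gap_pos_of_ne he n1 (one hj) (one hi) (h.vel_r j (one hj)) (h.vel_s i (one hi))
      (tp j hj).le (up i hi)
  · rw [h.gap_row_s he (one hi) (one hj)]
    exact h.row_s.gap_pos hi hj fun h3 => hxy (by rw [h3])
  · rw [gap_swap]; exact cs i hi
  · rw [gap_swap]
    exact gap_pos_of_ne he n3.symm hj (one hi) (v2 j hj) (h.vel_s i (one hi)) le_rfl (up i hi)
  · exact cr j hj
  · exact cs j hj
  · exact absurd rfl hxy
  · exact c2 j hj
  · exact gap_pos_of_ne he n2.symm hi (one hj) (v2 i hi) (h.vel_r j (one hj)) le_rfl (tp j hj)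
  · exact gap_pos_of_ne he n3.symm hi (one hj) (v2 i hi) (h.vel_s j (one hj)) le_rfl (up j hj)
  · rw [gap_swap]; exact c2 i hi
  · omega

end

section

variable {E : Type*} [NormedAddCommGroup E] [InnerProductSpace ℝ E]

theorem inner_hit_row {e : Fin 3 → E} (he : Frame e) (v : Fin 3 × ℕ → E) (r : Fin 3) (i : ℕ) :
    ⟪hit (e r) (r, i + 1) (r, i) v (r, i), e r⟫ = ⟪v (r, i + 1), e r⟫ := by
  rw [hit_right _ (by simp), inner_add_left, real_inner_smul_left, he.inner_self, inner_sub_left]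
  ring

theorem phase_single {e : Fin 3 → E} (he : Frame e) (a : ℕ) :
    Phase e a (Pi.single (2, 0) (-e 2)) 0 1 (4 / 5) 0 0 ∅ ∅ := by
  have row : ∀ q, Row a 0 ∅ q := fun q => by constructor <;> simp
  have ne : ∀ (x : Fin 3) (i : ℕ), 1 ≤ i → (x, i) ≠ (2, 0) := fun x i hi h => by
    have := (Prod.mk.inj h).2
    omega
  have val : ∀ x i, 1 ≤ i → (Pi.single (2, 0) (-e 2) : Fin 3 × ℕ → E) (x, i) = 0 :=
    fun x i hi => Pi.single_eq_of_ne (ne x i hi) _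
  constructor
  · exact Or.inl ⟨rfl, rfl⟩
  · exact row _
  · exact row _
  · norm_num
  · intro i hi
    simp
  · intro i hi
    simp
  · exact val 2
  · rw [Pi.single_eq_same, inner_neg_left, real_inner_comm, he.inner_zero_two, neg_neg]
  · rw [Pi.single_eq_same, inner_neg_left, real_inner_comm, he.inner_one_two, neg_zero]
  · simp
  · simp

theorem sorted_of_gap_pos {e : Fin 3 → E} {a b m : ℕ} {v : Fin 3 × ℕ → E}
    (h : ∀ x ∈ balls a b m, ∀ y ∈ balls a b m, x ≠ y → 0 < gap (pos e) v x y) :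
    v ∈ Sorted e 0 m := by
  intro i j _ hij hj
  have h1 := h (2, j) (mem_balls.2 (Or.inr (Or.inr ⟨rfl, hj⟩))) (2, i)
    (mem_balls.2 (Or.inr (Or.inr ⟨rfl, by omega⟩))) (fun h => by
      have := (Prod.mk.inj h).2
      omega)
  have h2 : (i : ℝ) < j := by exact_mod_cast hij
  rw [gap_pos_row] at h1
  have := (mul_pos_iff_of_pos_left (by linarith)).1 h1
  linarith

/-- The collisions following the insertion of another ball in the last row. -/
theorem exists_hist_succ {e : Fin 3 → E} (he : Frame e) {a m k : ℕ}
    (h : ∃ z ∈ Hist (pos e) (balls a a m) k, z.2 ∈ Sorted e 0 m) :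
    ∃ z ∈ Hist (pos e) (balls a a (m + 1)) (k + m + a * (a + 1)),
      ∀ x ∈ balls a a (m + 1), ∀ y ∈ balls a a (m + 1), x ≠ y → 0 < gap (pos e) z.2 x y := by
  obtain ⟨⟨y₀, v₀⟩, hz, hs⟩ := h
  have hj : ((2, m) : Fin 3 × ℕ) ∉ balls a a m := by simp [mem_balls]
  have i1 := he.inner_zero_one
  have i2 := he.inner_zero_two
  have i3 := he.inner_one_two
  have self := he.inner_self
  obtain ⟨y₁, h1, r1⟩ := Hist.exists_insert hz hj (e := e 2) (d := e 2 - e 1)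
    (fun i hi => two_le_norm_pos_sub he (Or.inl rfl) (isBall_of_mem hi)
      (fun hij => hj (hij ▸ hi)))
    (fun s hs q hq => by
      refine inner_pos_sub_pos ?_ ?_
      · rw [inner_add_right, real_inner_smul_right, inner_sub_right, self,
          real_inner_comm (e 1) (e 2), i3]
        linarith
      rcases mem_balls.1 hq with hq | hq | hq
      · refine Or.inr ⟨hq.2.1, ?_⟩
        rw [hq.1, inner_add_right, real_inner_smul_right, inner_sub_right, i1, i2]
        linarith
      · refine Or.inr ⟨hq.2.1, ?_⟩
        rw [hq.1, inner_add_right, real_inner_smul_right, inner_sub_right, self, i3]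
        linarith
      · exact Or.inl hq)
  rw [← balls_succ_two] at h1 r1
  have h1' : (y₁, Pi.single (2, 0 + m) (-e 2)) ∈ closure (Hist (pos e) (balls a a (m + 1)) k ∩
      {z | z.2 ∈ {v : Fin 3 × ℕ → E | ∀ i j, i < j → j < m + 1 → i ≠ 0 + m → j ≠ 0 + m →
        ⟪v (2, i), e 2⟫ < ⟪v (2, j), e 2⟫}}) := by
    rw [zero_add]
    refine closure_mono ?_ h1
    rintro ⟨y, v⟩ ⟨h2, c, hc, h3⟩
    refine ⟨h2, fun i j hij hj h4 h5 => ?_⟩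
    have mem : ∀ i, i < m → ((2, i) : Fin 3 × ℕ) ∈ balls a a m := fun i hi =>
      mem_balls.2 (Or.inr (Or.inr ⟨rfl, hi⟩))
    simp only [] at h3 ⊢
    rw [h3 _ (mem i (by omega)), h3 _ (mem j (by omega)), real_inner_smul_left,
      real_inner_smul_left]
    exact mul_lt_mul_of_pos_left (hs i j i.zero_le hij (by omega)) hc
  obtain ⟨y₂, h2, r2⟩ := chain he (m := 0) (n := m) (r := 2)
    (fun i _ hi => mem_balls.2 (Or.inr (Or.inr ⟨rfl, by omega⟩)))
    (fun p _ i hi hnb => by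
      rcases hnb with hnb | ⟨hnb, hnb'⟩ | ⟨hnb, -⟩
      · exact hnb
      · simp only at hnb'
        rw [hnb]
        exact ⟨rfl, Or.inl (by omega)⟩
      · have := (Prod.mk.inj hnb).2
        omega)
    (fun l => {v : Fin 3 × ℕ → E | ∀ i j, i < j → j < m + 1 → i ≠ l → j ≠ l →
        ⟪v (2, i), e 2⟫ < ⟪v (2, j), e 2⟫})
    (fun l v _ hl hv i j hij hj hil hjl => by
      have val : ∀ i, i ≠ l → i ≠ l + 1 →
          hit (e 2) (2, l + 1) (2, l) v (2, i) = v (2, i) := fun i h1 h2 =>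
        hit_of_ne _ (fun h => h2 (Prod.mk.inj h).2) (fun h => h1 (Prod.mk.inj h).2) _
      have vl := inner_hit_row he v 2 l
      by_cases h3 : i = l + 1
      · have := hv l j (by omega) hj (by omega) (by omega)
        rwa [vl, val j hjl (by omega), ← h3] at this
      by_cases h4 : j = l + 1
      · have := hv i l (by omega) (by omega) h3 (by omega)
        rwa [vl, val i hil h3, ← h4] at this
      · have := hv i j hij hj h3 h4
        rwa [val i hil h3, val j hjl h4] at this)
    h1' (by rw [zero_add]; exact r1 _)
  obtain ⟨y₃, v₃, r, s, q, t, u, h3, hp⟩ := (phase_single he a).run he (m := m) (k := k + m)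
    (n := a * (a + 1)) (by simp) (closure_mono (by
      rintro z ⟨h4, h5⟩
      exact ⟨h4, fun i j hi hij hj => h5 i j hij hj (by omega) (by omega)⟩) h2) r2
  have hev : ∀ᶠ z : (Fin 3 × ℕ → E) × (Fin 3 × ℕ → E) in 𝓝 (y₃, v₃),
      ∀ x ∈ balls a a (m + 1), ∀ y ∈ balls a a (m + 1), x ≠ y →
        (x.1 ≠ 2 ∨ y.1 ≠ 2 ∨ x.2 = 0 ∨ y.2 = 0) → 0 < gap (pos e) z.2 x y := by
    rw [Filter.eventually_all_finset]
    intro x hx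
    rw [Filter.eventually_all_finset]
    intro y hy
    by_cases h4 : x ≠ y ∧ (x.1 ≠ 2 ∨ y.1 ≠ 2 ∨ x.2 = 0 ∨ y.2 = 0)
    · have h5 := (((continuous_gap (pos e) x y).comp continuous_snd).tendsto
        (y₃, v₃)).eventually_const_lt (hp.gap_pos he hx hy h4.1 h4.2)
      exact h5.mono fun z hz _ _ => hz
    · exact Eventually.of_forall fun z h5 h6 => absurd ⟨h5, h6⟩ h4
  obtain ⟨⟨y, v⟩, ⟨h4, h5⟩, h6⟩ := ((mem_closure_iff_frequently.1 h3).and_eventually hev).exists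
  refine ⟨(y, v), h4, fun x hx y hy hxy => ?_⟩
  by_cases h7 : x.1 ≠ 2 ∨ y.1 ≠ 2 ∨ x.2 = 0 ∨ y.2 = 0
  · exact h6 x hx y hy hxy h7
  obtain ⟨x, i⟩ := x
  obtain ⟨y, j⟩ := y
  simp only [not_or, not_not] at h7
  obtain ⟨rfl, rfl, hi, hj⟩ := h7
  have b1 : i < m + 1 := by simpa [mem_balls] using hx
  have b2 : j < m + 1 := by simpa [mem_balls] using hy
  rw [gap_pos_row]
  rcases lt_trichotomy i j with h8 | h8 | h8
  · have h9 := h5 i j (by omega) h8 b2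
    have h10 : (i : ℝ) < j := by exact_mod_cast h8
    simp only at h9
    nlinarith
  · exact absurd (by rw [h8]) hxy
  · have h9 := h5 j i (by omega) h8 b1
    have h10 : (j : ℝ) < i := by exact_mod_cast h8
    simp only at h9
    nlinarith

/-- A configuration of `2 a + m + 1` balls with many collisions in the past, all of whose pairs
of balls separate in the future. -/
theorem exists_hist {e : Fin 3 → E} (he : Frame e) (a m : ℕ) :
    ∃ z ∈ Hist (pos e) (balls a a (m + 1)) (2 * (∑ i ∈ Finset.range a, i) +
        ∑ i ∈ Finset.range (m + 1), i + (m + 1) * (a * (a + 1))),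
      ∀ x ∈ balls a a (m + 1), ∀ y ∈ balls a a (m + 1), x ≠ y → 0 < gap (pos e) z.2 x y := by
  induction m with
  | zero =>
    obtain ⟨z, hz⟩ := nonempty_hist_one he a a
    rw [← two_mul] at hz
    have := exists_hist_succ he ⟨z, hz, fun i j _ _ hj => absurd hj j.not_lt_zero⟩
    simpa using this
  | succ m ih =>
    obtain ⟨z, hz, hg⟩ := ih
    have := exists_hist_succ he ⟨z, hz, sorted_of_gap_pos hg⟩
    have hk : ∀ x y w : ℕ, x + (y + (m + 1)) + (m + 1 + 1) * w =
        x + y + (m + 1) * w + (m + 1) + w := fun x y w => by ring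
    rwa [Finset.sum_range_succ _ (m + 1), hk]

end

theorem Hist.exists_past {ι : Type} {E : Type*} [DecidableEq ι] [NormedAddCommGroup E]
    [InnerProductSpace ℝ E] {X : ι → E} {S : Finset ι} {k : ℕ} {z : (ι → E) × (ι → E)}
    (hz : z ∈ Hist X S k) (hg : ∀ i ∈ S, ∀ j ∈ S, i ≠ j → 0 < gap X z.2 i j) :
    ∃ M p, Past S k M p z.2 ∧ ∀ i ∈ S, ∀ j ∈ S, i ≠ j → 0 ≤ ⟪p i - p j, z.2 i - z.2 j⟫ := by
  obtain ⟨-, M, hM⟩ := hz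
  have h1 : ∀ᶠ ε : ℝ in 𝓝[>] 0, Past S k M (X + ε • z.1) z.2 :=
    hM.curry.mono fun ε h => h.self_of_nhds
  have h2 : ∀ᶠ ε : ℝ in 𝓝[>] 0, ∀ i ∈ S, ∀ j ∈ S, i ≠ j →
      0 ≤ ⟪(X + ε • z.1) i - (X + ε • z.1) j, z.2 i - z.2 j⟫ := by
    refine Filter.Eventually.filter_mono nhdsWithin_le_nhds ?_
    rw [Filter.eventually_all_finset]
    intro i hi
    rw [Filter.eventually_all_finset]
    intro j hj
    by_cases hij : i = j
    · exact Eventually.of_forall fun _ h => absurd hij h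
    have hc : Continuous fun ε : ℝ => ⟪(X + ε • z.1) i - (X + ε • z.1) j, z.2 i - z.2 j⟫ := by
      simp only [Pi.add_apply, Pi.smul_apply]
      fun_prop
    have h3 := (hc.tendsto 0).eventually_const_lt (u := 0) (by
      simpa [gap] using hg i hi j hj hij)
    exact h3.mono fun ε h _ => h.le
  obtain ⟨ε, h3, h4⟩ := (h1.and h2).exists
  exact ⟨M, _, h3, h4⟩

/-- A past arriving at separating balls continues to a motion for all times. -/
theorem Past.exists_ballSystem {ι : Type} [DecidableEq ι] {d n k : ℕ} {S : Finset ι} {M : ℝ}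
    {p v : ι → EuclideanSpace ℝ (Fin d)} (h : Past S k M p v) (hS : S.card = n)
    (hv : ∀ i ∈ S, ∀ j ∈ S, i ≠ j → 0 ≤ ⟪p i - p j, v i - v j⟫) :
    ∃ B : BallSystem (Fin n) d univ, ∃ F : Finset (ℝ × Finset (Fin n)),
      ↑F ⊆ B.collisions ∧ k ≤ F.card := by
  obtain ⟨x, vl, vr, F, h⟩ := h
  obtain ⟨σ⟩ : Nonempty (Fin n ≃ S) := ⟨(S.equivFinOfCardEq hS).symm⟩
  have mem : ∀ i, (σ i : ι) ∈ S := fun i => (σ i).2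
  have ne : ∀ {i j}, i ≠ j → (σ i : ι) ≠ σ j := fun hij h =>
    hij (σ.injective (Subtype.ext h))
  have surj : ∀ {a}, a ∈ S → ∃ i, (σ i : ι) = a := fun {a} ha => ⟨σ.symm ⟨a, ha⟩, by simp⟩
  let B : BallSystem (Fin n) d univ :=
    { x := fun i t => if t ≤ 0 then x (σ i) t else p (σ i) + t • v (σ i)
      vl := fun i t => if t ≤ 0 then vl (σ i) t else v (σ i)
      vr := fun i t => if t < 0 then vr (σ i) t else v (σ i)
      right_lin := by
        intro i t _
        by_cases ht : t < 0
        · obtain ⟨δ, hδ, hs⟩ := h.right_lin _ (mem i) t ht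
          refine ⟨min δ (-t), lt_min hδ (by linarith), fun s hs' => ?_⟩
          have h1 := hs'.1.2
          have h2 := min_le_left δ (-t)
          have h3 := min_le_right δ (-t)
          rw [if_pos (by linarith), if_pos ht.le, if_pos ht]
          exact hs s ⟨hs'.1.1, by linarith⟩
        · refine ⟨1, one_pos, fun s hs' => ?_⟩
          have h1 := hs'.1.1
          have key : ∀ r : ℝ, 0 ≤ r → (if r ≤ 0 then x (σ i) r else p (σ i) + r • v (σ i)) =
              p (σ i) + r • v (σ i) := by
            intro r hr
            split_ifs with h2
            · rw [le_antisymm h2 hr, h.pos_zero _ (mem i), zero_smul, add_zero]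
            · rfl
          rw [key s (by linarith), key t (by linarith), if_neg ht]
          module
      left_lin := by
        intro i t _
        by_cases ht : t ≤ 0
        · obtain ⟨δ, hδ, hs⟩ := h.left_lin _ (mem i) t ht
          refine ⟨δ, hδ, fun s hs' => ?_⟩
          have h1 := hs'.1.2
          rw [if_pos (by linarith), if_pos ht, if_pos ht]
          exact hs s hs'.1
        · refine ⟨t / 2, by linarith, fun s hs' => ?_⟩
          have h1 := hs'.1.1
          rw [if_neg (by linarith), if_neg ht, if_neg ht]
          module
      dist_ge := by
        intro i j hij t _
        by_cases ht : t ≤ 0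
        · rw [if_pos ht, if_pos ht]
          exact h.dist_ge _ (mem i) _ (mem j) (ne hij) t ht
        · rw [if_neg ht, if_neg ht]
          have h1 := h.dist_ge _ (mem i) _ (mem j) (ne hij) 0 le_rfl
          rw [h.pos_zero _ (mem i), h.pos_zero _ (mem j)] at h1
          have h2 := separating_norm h1 (hv _ (mem i) _ (mem j) (ne hij)) (s := t) (by linarith)
          convert h2 using 1
          congr 1
          module
      collision_rule := by
        intro i t _ _ hne
        by_cases ht : t < 0
        · simp only [if_pos ht, if_pos ht.le] at hne ⊢
          obtain ⟨j, hj, h1, h2, h3, h4, h5, h6, h7⟩ := h.rule t ht _ (mem i) hne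
          obtain ⟨j, rfl⟩ := surj hj
          refine ⟨j, fun hji => h1 (by rw [hji]), h2, h3, fun l hl hd => ?_,
            fun l hli hlj => h5 _ (mem l) (ne hli) (ne hlj), h6, h7⟩
          exact σ.injective (Subtype.ext (h4 _ (mem l) (ne hl) hd))
        · refine absurd ?_ hne
          rw [if_neg ht]
          split_ifs with h1
          · rw [le_antisymm h1 (not_lt.1 ht), h.vel_zero _ (mem i)]
          · rfl }
  refine ⟨B, F.image fun q => (q.1, Finset.univ.filter fun i => (σ i : ι) ∈ q.2), ?_, ?_⟩
  · intro q hq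
    obtain ⟨⟨t, A⟩, hq', rfl⟩ := Finset.mem_image.1 hq
    obtain ⟨ht, a, ha, b, hb, hab, hA, h1, h2, h3⟩ := h.coll _ hq'
    obtain ⟨i, rfl⟩ := surj ha
    obtain ⟨j, rfl⟩ := surj hb
    simp only at ht hA h1 h2 h3
    refine ⟨mem_univ _, ⟨t - 1, mem_univ _, sub_one_lt t⟩, i, j, fun hij => hab (by rw [hij]),
      ?_, ?_, ?_, ?_⟩
    · ext l
      simp only [hA, Finset.mem_filter, Finset.mem_univ, true_and, Finset.mem_insert,
        Finset.mem_singleton, Subtype.coe_inj, σ.injective.eq_iff]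
    · simpa only [B, if_pos ht.le] using h1
    · simpa only [B, if_pos ht.le, if_pos ht] using h2
    · simpa only [B, if_pos ht.le, if_pos ht] using h3
  · rw [Finset.card_image_of_injOn]
    · exact h.card_le
    · have sub : ∀ q ∈ F, q.2 ⊆ S := by
        intro q hq
        obtain ⟨-, a, ha, b, hb, -, hA, -⟩ := h.coll q hq
        rw [hA]
        exact Finset.insert_subset ha (Finset.singleton_subset_iff.2 hb)
      rintro ⟨t, A⟩ hq ⟨t', A'⟩ hq' heq
      obtain ⟨h1, h2⟩ := Prod.mk.inj heq
      refine Prod.ext h1 (Finset.ext fun a => ?_)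
      constructor
      · intro ha
        obtain ⟨i, rfl⟩ := surj (sub _ hq ha)
        have := Finset.ext_iff.1 h2 i
        simpa using this.1 (by simpa using ha)
      · intro ha
        obtain ⟨i, rfl⟩ := surj (sub _ hq' ha)
        have := Finset.ext_iff.1 h2 i
        simpa using this.2 (by simpa using ha)

theorem exists_frame {d : ℕ} (hd : 2 ≤ d) : ∃ e : Fin 3 → EuclideanSpace ℝ (Fin d), Frame e := by
  obtain ⟨a, b, ha, hb, hab⟩ : ∃ a b : EuclideanSpace ℝ (Fin d), ⟪a, a⟫ = 1 ∧ ⟪b, b⟫ = 1 ∧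
      ⟪a, b⟫ = 0 := by
    refine ⟨EuclideanSpace.single ⟨0, by omega⟩ 1, EuclideanSpace.single ⟨1, by omega⟩ 1,
      ?_, ?_, ?_⟩
    · simp
    · simp
    · rw [EuclideanSpace.inner_single_left, PiLp.single_apply, if_neg (by simp),
        mul_zero]
  have hba : ⟪b, a⟫ = 0 := by rw [real_inner_comm]; exact hab
  refine ⟨![-(3 / 5 : ℝ) • a - (4 / 5 : ℝ) • b, a, b], ?_, ?_, ?_, hab, ?_⟩
  · intro r
    fin_cases r
    · simp only [Fin.zero_eta, Matrix.cons_val_zero, inner_sub_left, inner_sub_right,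
        real_inner_smul_left, real_inner_smul_right, ha, hb, hab, hba]
      norm_num
    · exact ha
    · exact hb
  · simp only [Matrix.cons_val_zero, Matrix.cons_val_one, inner_sub_left, real_inner_smul_left, ha,
      hba]
    norm_num
  · simp only [Matrix.cons_val_zero, Matrix.cons_val, inner_sub_left, real_inner_smul_left, hb, hab]
    norm_num
  · simp only [Matrix.cons_val_zero, Matrix.cons_val_one, Matrix.cons_val]
    module

end HardBall

/-- For every `n ≥ 3` and `d ≥ 2` there is an elastic collision system
of `n` unit balls in `ℝ^d`, on the time interval `ℝ`, with at least `f n` collisions. -/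
theorem ball_collisions_ge_f (n d : ℕ) (hn : 3 ≤ n) (hd : 2 ≤ d) :
    ∃ S : BallSystem (Fin n) d Set.univ, ∃ F : Finset (ℝ × Finset (Fin n)),
      ↑F ⊆ S.collisions ∧ f n ≤ F.card := by
  obtain ⟨e, he⟩ := HardBall.exists_frame hd
  obtain ⟨m, hm⟩ : ∃ m, n - 2 * (n / 3) = m + 1 := ⟨n - 2 * (n / 3) - 1, by omega⟩
  obtain ⟨z, hz, hg⟩ := HardBall.exists_hist he (n / 3) m
  obtain ⟨M, p, hp, hv⟩ := HardBall.Hist.exists_past hz hg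
  obtain ⟨B, F, hF, hk⟩ := hp.exists_ballSystem (n := n)
    (by rw [HardBall.card_balls]; omega) hv
  refine ⟨B, F, hF, le_of_eq_of_le ?_ hk⟩
  rw [f, nOne, nTwo, hm, Finset.sum_range_id (m + 1), mul_comm 2, Finset.sum_range_id_mul_two]
  ring
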